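/- Let k be a field, A a finite-dimensional self-injective k-algebra, and M a finitely generated A-module that is a generator, self-orthogonal and Nakayama-stable. Let 0 → M → I → Ω_A^{-}(M) → 0 be exact with M → I an injective envelope, and let f : Ω_A^{-}(M) → W be a minimal left 𝒢-approximation. Then M is a projective A-module if and only if W is a filtered colimit of finitely generated modules lying in 𝒢. (Theorem 1.2, equivalence of (1) and (4).) -/

import Mathlib

open CategoryTheory
/-! ## Additive closure classes -/

section AddClosure

variable (A : Type) [Ring A]

/-- `X ∈ add M`: `X` is a direct summand of a finite direct sum of copies of `M`. -/
def MemAdd (M X : ModuleCat.{0} A) : Prop :=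
  ∃ (n : ℕ) (Y : ModuleCat.{0} A), Nonempty ((↥X × ↥Y) ≃ₗ[A] (Fin n → ↥M))

/-- `X ∈ Add M`: `X` is a direct summand of an arbitrary direct sum of copies of `M`. -/
def MemAddBig (M X : ModuleCat.{0} A) : Prop :=
  ∃ (I : Type) (Y : ModuleCat.{0} A), Nonempty ((↥X × ↥Y) ≃ₗ[A] (I →₀ ↥M))

/-- a morphism of `A`-modules factors through a projective module -/
def FactorsThroughProj {X Y : ModuleCat.{0} A} (f : X ⟶ Y) : Prop :=
  ∃ (P : ModuleCat.{0} A) (_ : Module.Projective A P) (g : X ⟶ P) (h : P ⟶ Y), f = g ≫ h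

/-- a morphism of `A`-modules factors through a module in `Add M` -/
def FactorsThroughAddM (M : ModuleCat.{0} A) {X Y : ModuleCat.{0} A} (f : X ⟶ Y) : Prop :=
  ∃ (Z : ModuleCat.{0} A) (_ : MemAddBig A M Z) (g : X ⟶ Z) (h : Z ⟶ Y), f = g ≫ h

/-- `X ∈ add M` for unbundled modules. -/
def MemAddPlain (M : Type) [AddCommGroup M] [Module A M]
    (X : Type) [AddCommGroup X] [Module A X] : Prop :=
  ∃ (n : ℕ) (Y : ModuleCat.{0} A), Nonempty ((X × ↥Y) ≃ₗ[A] (Fin n → M))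

end AddClosure

/-! ## Ext vanishing -/

section ExtDefs

variable (A : Type) [Ring A]

/-- vanishing of `Ext^n_A(X, Y)` -/
noncomputable def extZero (n : ℕ) (X Y : ModuleCat.{0} A) : Prop :=
  Subsingleton (((Ext ℤ (ModuleCat.{0} A) n).obj (Opposite.op X)).obj Y)

/-- `M` is self-orthogonal: `Ext^n_A(M,M) = 0` for all `n ≥ 1`. -/
noncomputable def SelfOrthogonal (M : ModuleCat.{0} A) : Prop :=
  ∀ n : ℕ, 1 ≤ n → extZero A n M M

/-- `M` is a generator for `A`-mod: `A ∈ add M`. -/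
def IsGen (M : ModuleCat.{0} A) : Prop :=
  MemAdd A M (ModuleCat.of A A)

/-- membership in the `M`-Gorenstein subcategory `𝒢`:
`Ext^n_A(M,X) = 0 = Ext^n_A(X,M)` for all `n ≥ 1`. -/
noncomputable def MemG (M X : ModuleCat.{0} A) : Prop :=
  ∀ n : ℕ, 1 ≤ n → extZero A n M X ∧ extZero A n X M

end ExtDefs

/-! ## The Nakayama functor `ν_A = D ∘ Hom_A(-, A)` -/

section Nakayama

variable (k A : Type) [Field k] [Ring A] [Algebra k A]

/-- Right multiplication by `a : A` on `Hom_A(X, A)`, as a `k`-linear map. -/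
@[simps] def rmulHom (X : Type) [AddCommGroup X] [Module A X] (a : A) :
    (X →ₗ[A] A) →ₗ[k] (X →ₗ[A] A) where
  toFun f :=
    { toFun := fun x => f x * a
      map_add' := fun x y => by simp [add_mul]
      map_smul' := fun c x => by simp [mul_assoc] }
  map_add' f g := by ext x; simp [add_mul]
  map_smul' c f := by ext x; simp [Algebra.smul_def, mul_assoc]

/-- The carrier of the Nakayama functor value `ν_A(X) = D(Hom_A(X,A))`,
where `D = Hom_k(-,k)`. -/
abbrev NuCarrier (X : Type) [AddCommGroup X] [Module A X] : Type :=
  (X →ₗ[A] A) →ₗ[k] k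

/-- The left `A`-module structure on `ν_A(X) = D(Hom_A(X,A))`: `(a • φ) f = φ (f · a)`. -/
instance (X : Type) [AddCommGroup X] [Module A X] : Module A (NuCarrier k A X) where
  smul a φ := φ.comp (rmulHom k A X a)
  one_smul φ := by
    refine LinearMap.ext fun f => ?_
    exact congrArg φ (by ext x; simp)
  mul_smul a b φ := by
    refine LinearMap.ext fun f => ?_
    exact congrArg φ (by ext x; simp [mul_assoc])
  smul_zero a := rfl
  smul_add a φ ψ := rfl
  add_smul a b φ := by
    refine LinearMap.ext fun f => ?_
    show φ ((rmulHom k A X (a + b)) f) = φ ((rmulHom k A X a) f) + φ ((rmulHom k A X b) f)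
    rw [show (rmulHom k A X (a + b)) f = (rmulHom k A X a) f + (rmulHom k A X b) f from by
      ext x; simp [mul_add]]
    exact map_add φ _ _
  zero_smul φ := by
    refine LinearMap.ext fun f => ?_
    show φ ((rmulHom k A X 0) f) = 0
    rw [show (rmulHom k A X 0) f = 0 from by ext x; simp]
    exact map_zero φ

/-- The Nakayama functor value `ν_A(X)` as an object of `ModuleCat A`. -/
noncomputable def NuMod (X : ModuleCat.{0} A) : ModuleCat.{0} A :=
  ModuleCat.of A (NuCarrier k A ↥X)

/-- `M` is Nakayama-stable: `add M = add (ν_A M)`. -/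
noncomputable def NakayamaStable (M : ModuleCat.{0} A) : Prop :=
  ∀ X : ModuleCat.{0} A, MemAdd A M X ↔ MemAdd A (NuMod k A M) X

end Nakayama

/-! ## Minimal injective coresolutions, cosyzygies, `M`-filtered modules -/

section Cosyzygy

variable (A : Type) [Ring A]

/-- `ι : N ⟶ I` is an injective envelope: `I` is injective, `ι` is injective,
and the image of `ι` is an essential submodule of `I`. -/
def IsInjEnvelope {N I : ModuleCat.{0} A} (ι : N ⟶ I) : Prop :=
  Module.Injective A ↥I ∧ Function.Injective ι ∧
    ∀ K : Submodule A ↥I, K ⊓ LinearMap.range ι.hom = ⊥ → K = ⊥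

/-- `C` is the sequence of cosyzygies of `M` along a minimal injective coresolution:
`C 0 ≅ M` and for each `n` there is a short exact sequence `0 → C n → I → C (n+1) → 0`
in which `C n → I` is an injective envelope. -/
def IsMinInjCoresolution (M : ModuleCat.{0} A) (C : ℕ → ModuleCat.{0} A) : Prop :=
  Nonempty (C 0 ≅ M) ∧
    ∀ n, ∃ (I : ModuleCat.{0} A) (ι : C n ⟶ I) (p : I ⟶ C (n + 1)),
      IsInjEnvelope A ι ∧ Function.Surjective p ∧ LinearMap.range ι.hom = LinearMap.ker p.hom

/-- the family of modules `{A} ∪ {C i | i ∈ ℕ}`, indexed by `Option ℕ`. -/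
def optPick (C : ℕ → ModuleCat.{0} A) : Option ℕ → ModuleCat.{0} A
  | none => ModuleCat.of A A
  | some i => C i

/-- `Q` is isomorphic to a finite direct sum of modules from `{A} ∪ {C i | i ∈ ℕ}`. -/
def IsFinSumFrom (C : ℕ → ModuleCat.{0} A) (Q : Type) [AddCommGroup Q] [Module A Q] : Prop :=
  ∃ (m : ℕ) (T : Fin m → Option ℕ),
    Nonempty (Q ≃ₗ[A] ((j : Fin m) → ↥(optPick A C (T j))))

/-- `X` is `M`-filtered (where `C` encodes the cosyzygies `Ω_A^{-i}(M)`, `C 0 ≅ M`):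
there is an ascending chain `0 = X₀ ⊆ X₁ ⊆ ⋯` of submodules with union `X` all of whose
subquotients are finite direct sums of modules from `{A} ∪ {Ω_A^{-i}(M) | i ∈ ℕ}`. -/
def MFiltered (C : ℕ → ModuleCat.{0} A) (X : ModuleCat.{0} A) : Prop :=
  ∃ F : ℕ → Submodule A ↥X,
    Monotone F ∧ F 0 = ⊥ ∧ (⨆ n, F n) = ⊤ ∧
      ∀ n, IsFinSumFrom A C
        (↥(F (n + 1)) ⧸ (Submodule.comap (F (n + 1)).subtype (F n)))

/-- `X` is finitely `M`-filtered: as `MFiltered`, with a chain that reaches `⊤`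
after finitely many steps. -/
def FinMFiltered (C : ℕ → ModuleCat.{0} A) (X : ModuleCat.{0} A) : Prop :=
  ∃ F : ℕ → Submodule A ↥X,
    Monotone F ∧ F 0 = ⊥ ∧ (∃ n, F n = ⊤) ∧
      ∀ n, IsFinSumFrom A C
        (↥(F (n + 1)) ⧸ (Submodule.comap (F (n + 1)).subtype (F n)))

end Cosyzygy

/-! ## Approximations -/

section Approx

variable (A : Type) [Ring A]

/-- `f : X ⟶ W` is a left `𝒢`-approximation of `X`. -/
noncomputable def IsLeftGApprox (M : ModuleCat.{0} A) {X W : ModuleCat.{0} A}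
    (f : X ⟶ W) : Prop :=
  MemG A M W ∧ ∀ (G : ModuleCat.{0} A), MemG A M G → ∀ g : X ⟶ G, ∃ h : W ⟶ G, g = f ≫ h

/-- `f : X ⟶ W` is left minimal. -/
def LeftMinimal {X W : ModuleCat.{0} A} (f : X ⟶ W) : Prop :=
  ∀ α : W ⟶ W, f ≫ α = f → Function.Bijective α

end Approx

/-! ## Filtered colimits -/

section FiltColim

variable (A : Type) [Ring A]

/-- `X` is a filtered colimit of finitely generated modules lying in `𝒢`. -/
noncomputable def FiltColimOfFgG (M X : ModuleCat.{0} A) : Prop :=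
  ∃ (J : Cat.{0, 0}) (_ : IsFiltered J) (F : J ⥤ ModuleCat.{0} A)
    (c : Limits.Cocone F),
    (∀ j, Module.Finite A (F.obj j) ∧ MemG A M (F.obj j)) ∧
      Nonempty (Limits.IsColimit c) ∧ Nonempty (c.pt ≅ X)

end FiltColim

/-! ## Comparison of the two definitions of `Ext` -/

section ExtComparison

variable {A : Type} [Ring A]

lemma extZero_succ_iff (n : ℕ) (X Y : ModuleCat.{0} A) :
    extZero A (n + 1) X Y ↔ Subsingleton (Abelian.Ext X Y (n + 1)) := by
  let P := projectiveResolution X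
  have hzero : extZero A (n + 1) X Y ↔ (P.complex.linearYonedaObj ℤ Y).ExactAt (n + 1) := by
    rw [HomologicalComplex.exactAt_iff_isZero_homology, extZero,
      ← ModuleCat.isZero_iff_subsingleton]
    exact (P.isoExt (R := ℤ) (n + 1) Y).isZero_iff
  rw [hzero, HomologicalComplex.exactAt_iff' _ n (n + 1) (n + 2) (by simp) (by simp),
    ShortComplex.moduleCat_exact_iff]
  constructor
  · intro h
    refine subsingleton_of_forall_eq 0 fun α => ?_
    obtain ⟨f, hf, rfl⟩ := P.extMk_surjective α (n + 2) rfl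
    rw [P.extMk_eq_zero_iff f (n + 2) rfl hf n rfl]
    exact h f hf
  · intro h f hf
    exact (P.extMk_eq_zero_iff f (n + 2) rfl hf n rfl).1 (Subsingleton.elim _ _)

end ExtComparison

/-! ## Orthogonality with respect to all positive `Ext` groups -/

section Orth

variable {A : Type} [Ring A]

/-- `Ext^n(X, Y) = 0` for all `n ≥ 1`. -/
def Orth (X Y : ModuleCat.{0} A) : Prop :=
  ∀ n : ℕ, Subsingleton (Abelian.Ext X Y (n + 1))

lemma orth_iff_extZero {X Y : ModuleCat.{0} A} :
    Orth X Y ↔ ∀ n : ℕ, 1 ≤ n → extZero A n X Y := by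
  constructor
  · rintro h (_ | n) hn
    · omega
    · exact (extZero_succ_iff n X Y).2 (h n)
  · exact fun h n => (extZero_succ_iff n X Y).1 (h (n + 1) (by omega))

lemma memG_iff {M X : ModuleCat.{0} A} : MemG A M X ↔ Orth M X ∧ Orth X M := by
  rw [orth_iff_extZero, orth_iff_extZero]
  exact ⟨fun h => ⟨fun n hn => (h n hn).1, fun n hn => (h n hn).2⟩,
    fun h n hn => ⟨h.1 n hn, h.2 n hn⟩⟩

lemma orth_of_projective (X Y : ModuleCat.{0} A) [Projective X] : Orth X Y :=
  fun n => Abelian.Ext.subsingleton_of_projective X Y n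

lemma orth_of_injective (X Y : ModuleCat.{0} A) [Injective Y] : Orth X Y :=
  fun n => Abelian.Ext.subsingleton_of_injective X Y n

lemma shortExact_of_linearMap {X Y Z : ModuleCat.{0} A} (f : X ⟶ Y) (g : Y ⟶ Z)
    (hf : Function.Injective f) (hg : Function.Surjective g)
    (hfg : LinearMap.range f.hom = LinearMap.ker g.hom) :
    (ShortComplex.mk f g (by
      ext x
      have : f.hom x ∈ LinearMap.ker g.hom := hfg ▸ LinearMap.mem_range_self _ x
      simpa using this)).ShortExact where
  exact := by
    rw [ShortComplex.moduleCat_exact_iff_range_eq_ker]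
    exact hfg
  mono_f := (ModuleCat.mono_iff_injective _).2 hf
  epi_g := (ModuleCat.epi_iff_surjective _).2 hg

variable {S T : ShortComplex (ModuleCat.{0} A)} {C G N Y : ModuleCat.{0} A}

lemma Orth.middle (hS : S.ShortExact) (h₁ : Orth C S.X₁) (h₃ : Orth C S.X₃) : Orth C S.X₂ := by
  refine fun n => subsingleton_of_forall_eq 0 fun x => ?_
  have := h₁ n
  have := h₃ n
  obtain ⟨y, rfl⟩ := Abelian.Ext.covariant_sequence_exact₂ C hS x (Subsingleton.elim _ _)
  rw [Subsingleton.elim y 0, Abelian.Ext.zero_comp]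

lemma Orth.right (hS : S.ShortExact) (h₁ : Orth C S.X₁) (h₂ : Orth C S.X₂) : Orth C S.X₃ := by
  refine fun n => subsingleton_of_forall_eq 0 fun x => ?_
  have := h₁ (n + 1)
  have := h₂ n
  obtain ⟨y, rfl⟩ := Abelian.Ext.covariant_sequence_exact₃ C hS x rfl (Subsingleton.elim _ _)
  rw [Subsingleton.elim y 0, Abelian.Ext.zero_comp]

lemma subsingleton_ext_syzygy (hS : S.ShortExact) [Projective S.X₂] (n : ℕ)
    (h : Subsingleton (Abelian.Ext S.X₃ N (n + 2))) :
    Subsingleton (Abelian.Ext S.X₁ N (n + 1)) := by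
  refine subsingleton_of_forall_eq 0 fun x => ?_
  have : Subsingleton (Abelian.Ext S.X₂ N (n + 1)) := orth_of_projective S.X₂ N n
  obtain ⟨y, rfl⟩ := Abelian.Ext.contravariant_sequence_exact₁ hS N x (n₁ := n + 2) (by omega)
    (Subsingleton.elim _ _)
  rw [Subsingleton.elim y 0, Abelian.Ext.comp_zero]

lemma subsingleton_ext_of_syzygy (hS : S.ShortExact) [Projective S.X₂] (n : ℕ)
    (h : Subsingleton (Abelian.Ext S.X₁ N (n + 1))) :
    Subsingleton (Abelian.Ext S.X₃ N (n + 2)) := by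
  refine subsingleton_of_forall_eq 0 fun x => ?_
  have : Subsingleton (Abelian.Ext S.X₂ N (n + 2)) := orth_of_projective S.X₂ N (n + 1)
  obtain ⟨y, rfl⟩ := Abelian.Ext.contravariant_sequence_exact₃ hS N x (Subsingleton.elim _ _)
    (n₀ := n + 1) (by omega)
  rw [Subsingleton.elim y 0, Abelian.Ext.comp_zero]

lemma subsingleton_ext_cosyzygy (hS : S.ShortExact) [Injective S.X₂] (n : ℕ)
    (h : Subsingleton (Abelian.Ext C S.X₁ (n + 2))) :
    Subsingleton (Abelian.Ext C S.X₃ (n + 1)) := by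
  refine subsingleton_of_forall_eq 0 fun x => ?_
  have : Subsingleton (Abelian.Ext C S.X₂ (n + 1)) := orth_of_injective C S.X₂ n
  obtain ⟨y, rfl⟩ := Abelian.Ext.covariant_sequence_exact₃ C hS x rfl (Subsingleton.elim _ _)
  rw [Subsingleton.elim y 0, Abelian.Ext.zero_comp]

lemma subsingleton_ext_of_cosyzygy (hS : S.ShortExact) [Injective S.X₂] (n : ℕ)
    (h : Subsingleton (Abelian.Ext C S.X₃ (n + 1))) :
    Subsingleton (Abelian.Ext C S.X₁ (n + 2)) := by
  refine subsingleton_of_forall_eq 0 fun x => ?_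
  have : Subsingleton (Abelian.Ext C S.X₂ (n + 2)) := orth_of_injective C S.X₂ (n + 1)
  obtain ⟨y, rfl⟩ := Abelian.Ext.covariant_sequence_exact₁ C hS x (Subsingleton.elim _ _)
    (n₀ := n + 1) rfl
  rw [Subsingleton.elim y 0, Abelian.Ext.zero_comp]

lemma Orth.cosyzygy_right (hS : S.ShortExact) [Injective S.X₂] (h : Orth C S.X₁) : Orth C S.X₃ :=
  h.right hS (orth_of_injective _ _)

lemma Orth.cosyzygy (hS : S.ShortExact) (hT : T.ShortExact) [Projective S.X₂] [Injective T.X₂]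
    (h : Orth S.X₁ T.X₁) : Orth S.X₃ T.X₃ :=
  fun n => subsingleton_ext_cosyzygy hT n (subsingleton_ext_of_syzygy hS n (h n))

lemma Orth.of_sum {ι : Type*} [Fintype ι] (a : ι → (Y ⟶ N)) (b : ι → (N ⟶ Y))
    (hab : ∑ i, a i ≫ b i = 𝟙 Y) (h : Orth C N) : Orth C Y := by
  refine fun n => subsingleton_of_forall_eq 0 fun x => ?_
  have := h n
  rw [← Abelian.Ext.comp_mk₀_id x, ← hab, Abelian.Ext.mk₀_sum, Abelian.Ext.comp_sum]
  refine Finset.sum_eq_zero fun i _ => ?_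
  rw [← Abelian.Ext.mk₀_comp_mk₀, ← Abelian.Ext.comp_assoc_of_second_deg_zero,
    Subsingleton.elim (x.comp (Abelian.Ext.mk₀ (a i)) _) 0, Abelian.Ext.zero_comp]

/-- If `Ext^1(S.X₃, N) = 0`, then morphisms `S.X₁ ⟶ N` extend to `S.X₂`. -/
lemma exists_extension_of_subsingleton_ext (hS : S.ShortExact)
    (h : Subsingleton (Abelian.Ext S.X₃ N 1)) (g : S.X₁ ⟶ N) : ∃ g' : S.X₂ ⟶ N, S.f ≫ g' = g := by
  obtain ⟨x, hx⟩ := Abelian.Ext.contravariant_sequence_exact₁ hS N (Abelian.Ext.mk₀ g)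
    (n₁ := 1) (by omega) (Subsingleton.elim _ _)
  refine ⟨Abelian.Ext.addEquiv₀ x, ?_⟩
  apply (Abelian.Ext.mk₀_bijective _ _).1
  rw [← hx, ← Abelian.Ext.mk₀_comp_mk₀, Abelian.Ext.mk₀_addEquiv₀_apply]

lemma subsingleton_ext_one_of_extension (hS : S.ShortExact) [Projective S.X₂]
    (h : ∀ g : S.X₁ ⟶ N, ∃ g' : S.X₂ ⟶ N, S.f ≫ g' = g) :
    Subsingleton (Abelian.Ext S.X₃ N 1) := by
  refine subsingleton_of_forall_eq 0 fun x => ?_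
  have : Subsingleton (Abelian.Ext S.X₂ N 1) := orth_of_projective S.X₂ N 0
  obtain ⟨y, rfl⟩ := Abelian.Ext.contravariant_sequence_exact₃ hS N x (Subsingleton.elim _ _)
    (n₀ := 0) (by omega)
  obtain ⟨g', hg'⟩ := h (Abelian.Ext.addEquiv₀ y)
  rw [← Abelian.Ext.mk₀_addEquiv₀_apply y, ← hg', ← Abelian.Ext.mk₀_comp_mk₀,
    hS.extClass_comp_assoc]

lemma subsingleton_ext_one_of_lift (hS : S.ShortExact) [Injective S.X₂]
    (h : ∀ g : C ⟶ S.X₃, ∃ g' : C ⟶ S.X₂, g' ≫ S.g = g) :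
    Subsingleton (Abelian.Ext C S.X₁ 1) := by
  refine subsingleton_of_forall_eq 0 fun x => ?_
  have : Subsingleton (Abelian.Ext C S.X₂ 1) := orth_of_injective C S.X₂ 0
  obtain ⟨y, rfl⟩ := Abelian.Ext.covariant_sequence_exact₁ C hS x (Subsingleton.elim _ _)
    (n₀ := 0) rfl
  obtain ⟨g', hg'⟩ := h (Abelian.Ext.addEquiv₀ y)
  rw [← Abelian.Ext.mk₀_addEquiv₀_apply y, ← hg', ← Abelian.Ext.mk₀_comp_mk₀,
    Abelian.Ext.comp_assoc_of_second_deg_zero, hS.comp_extClass, Abelian.Ext.comp_zero]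

end Orth

/-! ## Finitely generated modules over a self-injective algebra embed in free modules -/

section SelfInjective

variable {A : Type} [Ring A]

variable (A) in
/-- The right annihilator of the Jacobson radical, which is the left socle of `A`
when `A` is Artinian. -/
def jacobsonAnnihilator : Ideal A where
  carrier := {v | ∀ j ∈ Ring.jacobson A, j * v = 0}
  add_mem' hv hw j hj := by rw [mul_add, hv j hj, hw j hj, add_zero]
  zero_mem' j _ := mul_zero j
  smul_mem' a v hv j hj := by
    rw [smul_eq_mul, ← mul_assoc]
    exact hv _ (Ideal.mul_mem_right a _ hj)

instance : (jacobsonAnnihilator A).IsTwoSided :=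
  ⟨fun b hv j hj => by rw [← mul_assoc, hv j hj, zero_mul]⟩

lemma exists_ne_zero_mem_jacobsonAnnihilator [IsArtinianRing A] {K : Ideal A} (hK : K ≠ ⊥) :
    ∃ y ∈ K, y ≠ 0 ∧ y ∈ jacobsonAnnihilator A := by
  classical
  obtain ⟨x, hxK, hx⟩ := Submodule.exists_mem_ne_zero_of_ne_bot hK
  obtain ⟨n, hn⟩ := IsSemiprimaryRing.isNilpotent (R := A)
  have hex : ∃ i : ℕ, ∃ y ∈ K, y ≠ 0 ∧ ∀ a ∈ Ring.jacobson A ^ i, a * y = 0 := by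
    refine ⟨n, x, hxK, hx, fun a ha => ?_⟩
    rw [hn] at ha
    rw [(Submodule.mem_bot A).1 ha, zero_mul]
  obtain ⟨y, hyK, hy, hann⟩ := Nat.find_spec hex
  rcases hi : Nat.find hex with _ | m
  · rw [hi, Submodule.pow_zero, Ideal.one_eq_top] at hann
    exact absurd (by simpa using hann 1 trivial) hy
  · have hmin := Nat.find_min hex (m := m) (by omega)
    push Not at hmin
    obtain ⟨a, ha, hay⟩ := hmin y hyK hy
    refine ⟨a * y, K.mul_mem_left a hyK, hay, fun j hj => ?_⟩
    rw [← mul_assoc]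
    refine hann _ ?_
    rw [hi, Ideal.IsTwoSided.pow_succ]
    exact Ideal.mul_mem_mul hj ha

lemma isSemisimpleModule_jacobsonAnnihilator [IsArtinianRing A] :
    IsSemisimpleModule A (jacobsonAnnihilator A) := by
  have hM : Module.IsTorsionBySet A (jacobsonAnnihilator A) (Ring.jacobson A) :=
    fun v j => Subtype.ext (v.2 j j.2)
  let _ := hM.module
  exact hM.isSemisimpleModule_iff.1 inferInstance

lemma mul_eq_zero_of_mem_jacobson [IsArtinianRing A] [Module.Injective A A] {v j : A}
    (hv : v ∈ jacobsonAnnihilator A) (hj : j ∈ Ring.jacobson A) : v * j = 0 := by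
  have := isSemisimpleModule_jacobsonAnnihilator (A := A)
  let φ : jacobsonAnnihilator A →ₗ[A] A :=
    (LinearMap.toSpanSingleton A A j).comp (jacobsonAnnihilator A).subtype
  obtain ⟨U, hU⟩ := exists_isCompl (LinearMap.ker φ)
  have hinj : Function.Injective (φ.comp U.subtype) := by
    rw [← LinearMap.ker_eq_bot, LinearMap.ker_comp, ← Submodule.disjoint_iff_comap_eq_bot]
    exact hU.disjoint.symm
  obtain ⟨h, hh⟩ := Module.Injective.extension_property A _ _ _ (φ.comp U.subtype) hinj
    ((jacobsonAnnihilator A).subtype.comp U.subtype)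
  have hU0 : U = ⊥ := by
    rw [eq_bot_iff]
    intro u hu
    have key : (u : A) = u * (j * h 1) := by
      have := LinearMap.congr_fun hh ⟨u, hu⟩
      calc (u : A) = h ((u : A) * j) := this.symm
        _ = ((u : A) * j) • h 1 := by rw [← map_smul, smul_eq_mul, mul_one]
        _ = u * (j * h 1) := by rw [smul_eq_mul, mul_assoc]
    have hpow : ∀ n : ℕ, (u : A) = u * (j * h 1) ^ n := by
      intro n
      induction n with
      | zero => simp
      | succ n ih => rw [pow_succ', ← mul_assoc, ← key, ← ih]
    obtain ⟨n, hn⟩ := IsSemiprimaryRing.isNilpotent (R := A)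
    have h0 : (j * h 1) ^ n ∈ Ring.jacobson A ^ n :=
      Ideal.pow_mem_pow (Ideal.mul_mem_right _ _ hj) n
    rw [hn] at h0
    rw [Submodule.mem_bot, Subtype.ext_iff, hpow n, (Submodule.mem_bot A).1 h0, mul_zero]
    rfl
  have htop : LinearMap.ker φ = ⊤ := by
    have := hU.sup_eq_top
    rwa [hU0, sup_bot_eq] at this
  have : (⟨v, hv⟩ : jacobsonAnnihilator A) ∈ LinearMap.ker φ := htop ▸ trivial
  exact this

lemma mem_jacobson_of_forall_mul_eq_zero (k : Type) [Field k] [Algebra k A] [FiniteDimensional k A]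
    {a : A} (ha : ∀ v ∈ jacobsonAnnihilator A, v * a = 0) : a ∈ Ring.jacobson A := by
  have : IsArtinianRing A := IsArtinianRing.of_finite k A
  rw [← Ideal.jacobson_bot, Ideal.mem_jacobson_iff]
  intro y
  have hinj : Function.Injective (LinearMap.mulRight k (1 + y * a)) := by
    rw [injective_iff_map_eq_zero]
    by_contra! hne
    obtain ⟨x, hx, hx0⟩ := hne
    let K : Ideal A := LinearMap.ker (LinearMap.toSpanSingleton A A (1 + y * a))
    have hK : K ≠ ⊥ := by
      rw [Submodule.ne_bot_iff]
      exact ⟨x, hx, hx0⟩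
    obtain ⟨z, hzK, hz0, hz⟩ := exists_ne_zero_mem_jacobsonAnnihilator hK
    have hzK' : z * (1 + y * a) = 0 := hzK
    rw [mul_add, mul_one, ← mul_assoc, ha _ (Ideal.mul_mem_right y _ hz), add_zero] at hzK'
    exact hz0 hzK'
  obtain ⟨z, hz⟩ := LinearMap.injective_iff_surjective.1 hinj 1
  refine ⟨z, (Submodule.mem_bot A).2 ?_⟩
  have : z * (1 + y * a) = 1 := hz
  rw [← this]
  noncomm_ring

/-- Finitely generated right ideals of a left self-injective ring are right annihilators. -/
lemma exists_eq_sum_mul_of_annihilator_le [Module.Injective A A] {n : ℕ} (x : Fin n → A) (y : A)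
    (h : ∀ a : A, (∀ i, a * x i = 0) → a * y = 0) : ∃ c : Fin n → A, y = ∑ i, x i * c i := by
  let φ : A →ₗ[A] (Fin n → A) := LinearMap.toSpanSingleton A (Fin n → A) x
  let ψ : A →ₗ[A] A := LinearMap.toSpanSingleton A A y
  have hker : LinearMap.ker φ ≤ LinearMap.ker ψ := fun a ha => h a fun i => congrFun ha i
  obtain ⟨g, hg⟩ := Module.Injective.extension_property A _ _ _
    ((LinearMap.ker φ).liftQ φ le_rfl)
    (LinearMap.ker_eq_bot.1 (Submodule.ker_liftQ_eq_bot _ _ _ le_rfl))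
    ((LinearMap.ker φ).liftQ ψ hker)
  refine ⟨fun i => g (Pi.single i 1), ?_⟩
  have h1 : g (φ 1) = ψ 1 := LinearMap.congr_fun hg (Submodule.Quotient.mk 1)
  have hx : x = ∑ i, x i • (Pi.single i 1 : Fin n → A) := pi_eq_sum_univ' x |>.trans (by
    refine Finset.sum_congr rfl fun i _ => ?_
    congr 1)
  calc y = g x := by simpa [φ, ψ] using h1.symm
    _ = ∑ i, x i * g (Pi.single i 1) := by
      conv_lhs => rw [hx]
      simp

lemma exists_mem_forall_sub_mul_mem_jacobson [IsArtinianRing A] (K : Ideal A) :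
    ∃ e ∈ K, ∀ x ∈ K, x - x * e ∈ Ring.jacobson A := by
  obtain ⟨e', hidem, he'⟩ := IsSemisimpleRing.ideal_eq_span_idempotent
    (K.map (Ideal.Quotient.mk (Ring.jacobson A)))
  obtain ⟨e, heK, hee⟩ := (Ideal.mem_map_iff_of_surjective _ Ideal.Quotient.mk_surjective).1
    (he' ▸ Ideal.mem_span_singleton_self e')
  refine ⟨e, heK, fun x hx => ?_⟩
  have hx' := Ideal.mem_map_of_mem (Ideal.Quotient.mk (Ring.jacobson A)) hx
  rw [he', Ideal.mem_span_singleton'] at hx'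
  obtain ⟨b, hb⟩ := hx'
  rw [← Ideal.Quotient.eq_zero_iff_mem, map_sub, map_mul, hee, ← hb, mul_assoc, hidem.eq, sub_self]

/-- The left annihilator of the product of `jacobsonAnnihilator A` and `K`. -/
def socleProdAnnihilator (K : Ideal A) : Ideal A where
  carrier := {a | ∀ v ∈ jacobsonAnnihilator A, ∀ x ∈ K, a * (v * x) = 0}
  add_mem' ha hb v hv x hx := by rw [add_mul, ha v hv x hx, hb v hv x hx, add_zero]
  zero_mem' _ _ _ _ := zero_mul _
  smul_mem' c a ha v hv x hx := by rw [smul_eq_mul, mul_assoc, ha v hv x hx, mul_zero]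

instance (K : Ideal A) : (socleProdAnnihilator K).IsTwoSided :=
  ⟨fun b ha v hv x hx => by
    rw [mul_assoc, ← mul_assoc b]
    exact ha _ (Ideal.mul_mem_left _ b hv) x hx⟩

lemma jacobson_le_socleProdAnnihilator (K : Ideal A) :
    Ring.jacobson A ≤ socleProdAnnihilator K :=
  fun j hj v hv x _ => by rw [← mul_assoc, hv j hj, zero_mul]

lemma socleProdAnnihilator_lt (k : Type) [Field k] [Algebra k A] [FiniteDimensional k A]
    [Module.Injective A A] {K K' : Ideal A} [K.IsTwoSided] (hJ : Ring.jacobson A ≤ K)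
    (hlt : K < K') : socleProdAnnihilator K' < socleProdAnnihilator K := by
  have : IsArtinianRing A := IsArtinianRing.of_finite k A
  refine lt_of_le_not_ge (fun a ha v hv x hx => ha v hv x (hlt.le hx)) fun hle => ?_
  refine hlt.not_ge fun a ha => ?_
  obtain ⟨e, heK, hright⟩ := exists_mem_forall_sub_mul_mem_jacobson K
  let R : Submodule k A := Submodule.span k {y | ∃ v ∈ jacobsonAnnihilator A, ∃ x ∈ K, y = v * x}
  obtain ⟨n, r, hr⟩ := Submodule.fg_iff_exists_fin_generating_family.1
    (IsNoetherian.noetherian R)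
  have hR : ∀ y ∈ R, ∀ c, y * c - y * c * e = 0 := by
    intro y hy c
    induction hy using Submodule.span_induction with
    | mem y hy =>
      obtain ⟨v, hv, x, hx, rfl⟩ := hy
      have := mul_eq_zero_of_mem_jacobson hv (hright (x * c) (Ideal.mul_mem_right c _ hx))
      rw [mul_sub] at this
      simpa only [mul_assoc] using this
    | zero => simp
    | add y z _ _ hy hz => rw [add_mul, add_mul, add_sub_add_comm, hy, hz, add_zero]
    | smul t y _ hy => rw [smul_mul_assoc, smul_mul_assoc, ← smul_sub, hy, smul_zero]
  have hmem : a - a * e ∈ Ring.jacobson A := by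
    refine mem_jacobson_of_forall_mul_eq_zero k fun v hv => ?_
    obtain ⟨c, hc⟩ := exists_eq_sum_mul_of_annihilator_le r (v * a) fun b hb => by
      refine hle (fun w hw x hx => ?_) v hv a ha
      have hwx : w * x ∈ Submodule.span k (Set.range r) :=
        hr ▸ Submodule.subset_span ⟨w, hw, x, hx, rfl⟩
      have hle' : Submodule.span k (Set.range r) ≤ LinearMap.ker (LinearMap.mulLeft k b) := by
        rw [Submodule.span_le]
        rintro _ ⟨i, rfl⟩
        exact hb i
      exact hle' hwx
    rw [mul_sub, ← mul_assoc, hc, Finset.sum_mul, ← Finset.sum_sub_distrib]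
    refine Finset.sum_eq_zero fun i _ => hR _ ?_ _
    rw [← hr]
    exact Submodule.subset_span ⟨i, rfl⟩
  rw [← sub_add_cancel a (a * e)]
  exact K.add_mem (hJ hmem) (K.mul_mem_left a heK)

/-- The left annihilator of the left socle is the Jacobson radical. -/
lemma socleProdAnnihilator_top_eq (k : Type) [Field k] [Algebra k A] [FiniteDimensional k A]
    [Module.Injective A A] : socleProdAnnihilator (⊤ : Ideal A) = Ring.jacobson A := by
  by_contra hne
  let L := {K : Ideal A // K.IsTwoSided ∧ Ring.jacobson A ≤ K}
  have hchain : ∀ n : ℕ, ∃ c : LTSeries L, c.length = n := by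
    intro n
    induction n with
    | zero => exact ⟨RelSeries.singleton _ ⟨⊤, inferInstance, le_top⟩, rfl⟩
    | succ n ih =>
      obtain ⟨c, hc⟩ := ih
      let d : LTSeries L :=
        { length := c.length
          toFun := fun i => ⟨socleProdAnnihilator (c.toFun i.rev).1, inferInstance,
            jacobson_le_socleProdAnnihilator _⟩
          step := fun i => by
            have := (c.toFun i.succ.rev).2.1
            refine socleProdAnnihilator_lt k (c.toFun i.succ.rev).2.2 ?_
            exact c.strictMono (Fin.rev_lt_rev.2 i.castSucc_lt_succ) }
      have h1 : socleProdAnnihilator (⊤ : Ideal A) ≤ d.head.1 :=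
        fun a ha v hv x hx => ha v hv x trivial
      have h2 : Ring.jacobson A < socleProdAnnihilator (⊤ : Ideal A) :=
        lt_of_le_of_ne (jacobson_le_socleProdAnnihilator _) (Ne.symm hne)
      have h3 : (⟨Ring.jacobson A, inferInstance, le_rfl⟩ : L) < d.head := h2.trans_le h1
      exact ⟨RelSeries.cons d _ h3, by rw [RelSeries.cons_length]; exact congrArg (· + 1) hc⟩
  obtain ⟨c, hc⟩ := hchain (Module.finrank k A + 1)
  have hmono : StrictMono fun K : L => Module.finrank k (K.1.restrictScalars k) := by
    intro K K' h
    exact Submodule.finrank_lt_finrank_of_lt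
      (show K.1.restrictScalars k < K'.1.restrictScalars k from h)
  have h1 := (c.map _ hmono).head_add_length_le_nat
  have h2 : (c.map _ hmono).last ≤ Module.finrank k A := Submodule.finrank_le _
  have h3 : (c.map _ hmono).length = c.length := rfl
  omega

lemma exists_linearMap_ne_zero_of_isSimpleModule (k : Type) [Field k] [Algebra k A]
    [FiniteDimensional k A] [Module.Injective A A] (m : Ideal A) [m.IsMaximal] :
    ∃ g : (A ⧸ m) →ₗ[A] A, g (Submodule.Quotient.mk 1) ≠ 0 := by
  have : IsArtinianRing A := IsArtinianRing.of_finite k A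
  obtain ⟨e, he, hright⟩ := exists_mem_forall_sub_mul_mem_jacobson m
  have hc : 1 - e ∉ socleProdAnnihilator (⊤ : Ideal A) := by
    rw [socleProdAnnihilator_top_eq k]
    intro h
    refine (Ideal.ne_top_iff_one m).1 (Ideal.IsMaximal.ne_top ‹_›) ?_
    simpa using m.add_mem (Ring.jacobson_le_of_isMaximal m h) he
  have hex : ∃ v ∈ jacobsonAnnihilator A, (1 - e) * v ≠ 0 := by
    by_contra! h
    exact hc fun v hv x _ => by rw [← mul_assoc, h v hv, zero_mul]
  obtain ⟨v, hv, hne⟩ := hex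
  refine ⟨Submodule.liftQ m (LinearMap.toSpanSingleton A A ((1 - e) * v)) fun x hx => ?_, ?_⟩
  · rw [LinearMap.mem_ker, LinearMap.toSpanSingleton_apply, smul_eq_mul, ← mul_assoc, mul_sub,
      mul_one]
    exact hv _ (hright x hx)
  · simpa using hne

/-- Over a self-injective finite-dimensional algebra, `A` is a cogenerator. -/
lemma exists_linearMap_apply_ne_zero (k : Type) [Field k] [Algebra k A]
    [FiniteDimensional k A] [Module.Injective A A] {N : Type} [AddCommGroup N] [Module A N]
    {x : N} (hx : x ≠ 0) : ∃ g : N →ₗ[A] A, g x ≠ 0 := by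
  let φ : A →ₗ[A] N := LinearMap.toSpanSingleton A N x
  have hker : LinearMap.ker φ ≠ ⊤ := by
    rw [Ideal.ne_top_iff_one]
    simpa [φ] using hx
  obtain ⟨m, hm, hle⟩ := Ideal.exists_le_maximal _ hker
  obtain ⟨g, hg⟩ := exists_linearMap_ne_zero_of_isSimpleModule k m
  obtain ⟨h, hh⟩ := Module.Injective.extension_property A _ _ _
    ((LinearMap.ker φ).liftQ φ le_rfl)
    (LinearMap.ker_eq_bot.1 (Submodule.ker_liftQ_eq_bot _ _ _ le_rfl))
    (g.comp ((LinearMap.ker φ).mapQ m LinearMap.id hle))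
  refine ⟨h, ?_⟩
  have h1 : h (φ 1) = g (Submodule.Quotient.mk 1) :=
    LinearMap.congr_fun hh (Submodule.Quotient.mk 1)
  rw [← h1] at hg
  simpa [φ] using hg

/-- Finitely generated modules over a self-injective finite-dimensional algebra embed in
finitely generated free modules. -/
lemma exists_injective_linearMap_fin (k : Type) [Field k] [Algebra k A]
    [FiniteDimensional k A] [Module.Injective A A] (N : Type) [AddCommGroup N] [Module A N]
    [Module.Finite A N] : ∃ (n : ℕ) (g : N →ₗ[A] (Fin n → A)), Function.Injective g := by
  have : IsArtinianRing A := IsArtinianRing.of_finite k A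
  have : IsArtinian A N := inferInstance
  obtain ⟨K, ⟨n, g, rfl⟩, hmin⟩ := IsArtinian.set_has_minimal
    {K : Submodule A N | ∃ (n : ℕ) (g : N →ₗ[A] (Fin n → A)), K = LinearMap.ker g}
    ⟨_, 0, 0, rfl⟩
  refine ⟨n, g, (injective_iff_map_eq_zero g).2 fun x hx => ?_⟩
  by_contra hx0
  obtain ⟨h, hh⟩ := exists_linearMap_apply_ne_zero (A := A) k hx0
  let g' : N →ₗ[A] (Fin (n + 1) → A) := LinearMap.pi (Fin.cons h fun i => LinearMap.proj i ∘ₗ g)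
  have hg' : ∀ y, g' y = 0 → h y = 0 ∧ g y = 0 := fun y hy =>
    ⟨congrFun hy 0, funext fun i => congrFun hy i.succ⟩
  refine hmin _ ⟨n + 1, g', rfl⟩ (lt_of_le_not_ge (fun y hy => (hg' y hy).2) fun hle => ?_)
  exact hh (hg' x (hle hx)).1

end SelfInjective

/-! ## The Nakayama functor and duality -/

section LinearMaps

variable {A P C Y : Type} [Ring A] [AddCommGroup P] [Module A P] [AddCommGroup C] [Module A C]
  [AddCommGroup Y] [Module A Y]

lemma exists_comp_eq_of_ker_le (q : P →ₗ[A] C) (hq : Function.Surjective q) (h : P →ₗ[A] Y)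
    (hle : LinearMap.ker q ≤ LinearMap.ker h) : ∃ h' : C →ₗ[A] Y, h'.comp q = h := by
  refine ⟨(LinearMap.ker q).liftQ h hle ∘ₗ (q.quotKerEquivOfSurjective hq).symm.toLinearMap, ?_⟩
  ext p
  have : (q.quotKerEquivOfSurjective hq).symm (q p) = Submodule.Quotient.mk p :=
    (LinearEquiv.symm_apply_eq _).2 rfl
  simp [this]

variable (A P) in
lemma exists_dual_basis_fin [Module.Finite A P] [Module.Projective A P] :
    ∃ (n : ℕ) (b : Fin n → P) (h : Fin n → (P →ₗ[A] A)), ∀ p, p = ∑ i, h i p • b i := by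
  obtain ⟨n, f, g, -, -, hfg⟩ := Module.Finite.exists_comp_eq_id_of_projective A P
  refine ⟨n, fun i => f (Pi.single i 1), fun i => LinearMap.proj i ∘ₗ g, fun p => ?_⟩
  conv_lhs => rw [← LinearMap.id_apply (R := A) p, ← hfg, LinearMap.comp_apply,
    f.pi_apply_eq_sum_univ]
  refine Finset.sum_congr rfl fun i _ => ?_
  congr 2
  ext j
  simp [Pi.single_apply, eq_comm]

end LinearMaps

section NakayamaDuality

variable (k : Type) {A : Type} [Field k] [Ring A] [Algebra k A]
variable {X P C Y : Type} [AddCommGroup X] [Module A X] [AddCommGroup P] [Module A P]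
  [AddCommGroup C] [Module A C] [AddCommGroup Y] [Module A Y]

/-- The action of the Nakayama functor on a linear map. -/
def nuMap (f : X →ₗ[A] P) : NuCarrier k A X →ₗ[A] NuCarrier k A P where
  toFun φ := φ.comp (LinearMap.lcomp k A f)
  map_add' _ _ := rfl
  map_smul' _ _ := rfl

@[simp] lemma nuMap_apply (f : X →ₗ[A] P) (φ : NuCarrier k A X) (h : P →ₗ[A] A) :
    nuMap k f φ h = φ (h.comp f) := rfl

lemma nuCarrier_smul_apply (a : A) (φ : NuCarrier k A X) (h : X →ₗ[A] A) :
    (a • φ) h = φ (rmulHom k A X a h) := rfl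

variable {k} in
lemma exists_dual_comp_eq {V W : Type} [AddCommGroup V] [Module k V] [AddCommGroup W] [Module k W]
    (u : V →ₗ[k] W) (γ : V →ₗ[k] k) (h : LinearMap.ker u ≤ LinearMap.ker γ) :
    ∃ δ : W →ₗ[k] k, δ.comp u = γ := by
  have : γ ∈ LinearMap.range u.dualMap := by
    rw [LinearMap.range_dualMap_eq_dualAnnihilator_ker, Submodule.mem_dualAnnihilator]
    exact fun w hw => h hw
  exact this

lemma nuMap_injective [Module.Injective A A] (i : X →ₗ[A] P) (hi : Function.Injective i) :
    Function.Injective (nuMap k i) := by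
  rw [injective_iff_map_eq_zero]
  intro φ hφ
  refine LinearMap.ext fun h => ?_
  obtain ⟨h', rfl⟩ := Module.Injective.extension_property A _ _ _ i hi h
  exact LinearMap.congr_fun hφ h'

lemma nuMap_surjective (q : P →ₗ[A] C) (hq : Function.Surjective q) :
    Function.Surjective (nuMap k q) := by
  intro ψ
  obtain ⟨δ, hδ⟩ := exists_dual_comp_eq (LinearMap.lcomp k A q) ψ fun h hh => by
    have : h = 0 := LinearMap.ext fun c => by
      obtain ⟨p, rfl⟩ := hq c
      exact LinearMap.congr_fun hh p
    rw [this]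
    exact map_zero ψ
  exact ⟨δ, hδ⟩

lemma nuMap_range_eq_ker (i : X →ₗ[A] P) (q : P →ₗ[A] C) (hq : Function.Surjective q)
    (hiq : LinearMap.range i = LinearMap.ker q) :
    LinearMap.range (nuMap k i) = LinearMap.ker (nuMap k q) := by
  have hqi : q.comp i = 0 := LinearMap.range_le_ker_iff.1 hiq.le
  apply le_antisymm
  · rintro _ ⟨φ, rfl⟩
    refine LinearMap.ext fun h => ?_
    rw [nuMap_apply, nuMap_apply, LinearMap.comp_assoc, hqi, LinearMap.comp_zero, map_zero]
    rfl
  · intro φ hφ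
    obtain ⟨δ, hδ⟩ := exists_dual_comp_eq (LinearMap.lcomp k A i) φ fun h hh => by
      have hle : LinearMap.ker q ≤ LinearMap.ker h := by
        rw [← hiq, LinearMap.range_le_ker_iff]
        exact hh
      obtain ⟨h', rfl⟩ := exists_comp_eq_of_ker_le q hq h hle
      exact LinearMap.congr_fun hφ h'
    exact ⟨δ, hδ⟩

variable [Module k Y] [IsScalarTower k A Y]

/-- The natural map `D Hom_A(P, Y) → Hom_A(Y, ν P)`. -/
def nuDuality (δ : (P →ₗ[A] Y) →ₗ[k] k) : Y →ₗ[A] NuCarrier k A P where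
  toFun y :=
    { toFun := fun h => δ ((LinearMap.toSpanSingleton A Y y).comp h)
      map_add' := fun h h' => by rw [LinearMap.comp_add, map_add]
      map_smul' := fun t h => by
        rw [RingHom.id_apply, ← map_smul]
        congr 1
        ext p
        simp }
  map_add' y z := by
    refine LinearMap.ext fun h => ?_
    refine (congrArg δ ?_).trans (map_add δ _ _)
    ext p
    simp
  map_smul' a y := by
    refine LinearMap.ext fun h => congrArg δ ?_
    ext p
    simp [mul_smul]

variable {k} in
lemma nuDuality_apply (δ : (P →ₗ[A] Y) →ₗ[k] k) (y : Y) (h : P →ₗ[A] A) :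
    nuDuality k δ y h = δ ((LinearMap.toSpanSingleton A Y y).comp h) := rfl

variable {k} in
lemma nuMap_comp_nuDuality (u : X →ₗ[A] P) (δ : (X →ₗ[A] Y) →ₗ[k] k) :
    (nuMap k u).comp (nuDuality k δ) = nuDuality k (δ.comp (LinearMap.lcomp k Y u)) := rfl

variable {k} in
lemma nuDuality_eq_zero [Module.Finite A P] [Module.Projective A P] (δ : (P →ₗ[A] Y) →ₗ[k] k)
    (hδ : nuDuality k δ = 0) : δ = 0 := by
  obtain ⟨n, b, h, hb⟩ := exists_dual_basis_fin A P
  ext φ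
  have : φ = ∑ i, (LinearMap.toSpanSingleton A Y (φ (b i))).comp (h i) := by
    ext p
    conv_lhs => rw [hb p]
    simp
  rw [this, map_sum]
  exact Finset.sum_eq_zero fun i _ =>
    LinearMap.congr_fun (LinearMap.congr_fun hδ (φ (b i))) (h i)

lemma nuDuality_surjective [Module.Finite A P] [Module.Projective A P]
    (g : Y →ₗ[A] NuCarrier k A P) : ∃ δ : (P →ₗ[A] Y) →ₗ[k] k, nuDuality k δ = g := by
  obtain ⟨n, b, h, hb⟩ := exists_dual_basis_fin A P
  have hg : ∀ (t : k) (y : Y) (h : P →ₗ[A] A), g (t • y) h = t * g y h := by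
    intro t y h
    rw [← algebraMap_smul A t y, map_smul, nuCarrier_smul_apply, ← smul_eq_mul, ← map_smul]
    congr 1
    ext p
    simp [Algebra.smul_def, Algebra.commutes]
  refine ⟨{ toFun := fun φ => ∑ i, g (φ (b i)) (h i), map_add' := ?_, map_smul' := ?_ }, ?_⟩
  · intro φ ψ
    simp [Finset.sum_add_distrib]
  · intro t φ
    simp [hg, Finset.mul_sum]
  · ext y h'
    have : h' = ∑ i, rmulHom k A P (h' (b i)) (h i) := by
      ext p
      conv_lhs => rw [hb p]
      simp
    rw [nuDuality_apply]
    conv_rhs => rw [this, map_sum]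
    change ∑ i, g (h' (b i) • y) (h i) = _
    refine Finset.sum_congr rfl fun i _ => ?_
    exact (LinearMap.congr_fun (map_smul g (h' (b i)) y) (h i))

lemma injective_nuCarrier [Module.Finite A P] [Module.Projective A P] :
    Module.Injective A (NuCarrier k A P) := by
  constructor
  intro X X' _ _ _ _ u hu g
  let _ : Module k X := Module.compHom X (algebraMap k A)
  let _ : Module k X' := Module.compHom X' (algebraMap k A)
  have : IsScalarTower k A X := ⟨fun t a x => by
    rw [Algebra.smul_def, mul_smul]; rfl⟩
  have : IsScalarTower k A X' := ⟨fun t a x => by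
    rw [Algebra.smul_def, mul_smul]; rfl⟩
  obtain ⟨γ, rfl⟩ := nuDuality_surjective k g
  let v : (P →ₗ[A] X) →ₗ[k] (P →ₗ[A] X') :=
    { toFun := fun φ => u.comp φ
      map_add' := fun φ ψ => LinearMap.comp_add _ _ _
      map_smul' := fun t φ => by
        ext p
        exact map_smul u (algebraMap k A t) (φ p) }
  obtain ⟨δ, hδ⟩ := exists_dual_comp_eq v γ fun φ hφ => by
    have : φ = 0 := LinearMap.ext fun p => hu (by
      simpa using LinearMap.congr_fun (show u.comp φ = 0 from hφ) p)
    rw [this]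
    exact map_zero γ
  refine ⟨nuDuality k δ, fun x => ?_⟩
  refine LinearMap.ext fun h => ?_
  rw [nuDuality_apply, nuDuality_apply, ← hδ]
  refine congrArg δ ?_
  ext p
  simp [v]

/-- Given short exact sequences `0 → X₀ → P₀ → X₁ → 0` and `0 → X₁ → P₁ → X₂ → 0` with `P₀` and
`P₁` finitely generated projective, if all maps `X₂ → Y` extend along an injective map from `X₂`
to a finitely generated projective module, then all maps `Y → ν X₁` lift to `ν P₀`. -/
lemma exists_lift_nuMap [Module.Injective A A] {P₀ P₁ P₂ X₁ X₂ : Type} [AddCommGroup P₀]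
    [Module A P₀] [AddCommGroup P₁] [Module A P₁] [AddCommGroup P₂] [Module A P₂] [AddCommGroup X₁]
    [Module A X₁] [AddCommGroup X₂] [Module A X₂] [Module.Finite A P₀] [Module.Projective A P₀]
    [Module.Finite A P₁] [Module.Projective A P₁] [Module.Finite A P₂] [Module.Projective A P₂]
    (q₀ : P₀ →ₗ[A] X₁) (hq₀ : Function.Surjective q₀)
    (i₁ : X₁ →ₗ[A] P₁) (hi₁ : Function.Injective i₁)
    (q₁ : P₁ →ₗ[A] X₂) (hq₁ : Function.Surjective q₁)
    (h₁ : LinearMap.range i₁ = LinearMap.ker q₁) (i₂ : X₂ →ₗ[A] P₂)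
    (hext : ∀ g : X₂ →ₗ[A] Y, ∃ g' : P₂ →ₗ[A] Y, g'.comp i₂ = g) (g : Y →ₗ[A] NuCarrier k A X₁) :
    ∃ g' : Y →ₗ[A] NuCarrier k A P₀, (nuMap k q₀).comp g' = g := by
  obtain ⟨γ, hγ⟩ := nuDuality_surjective k ((nuMap k i₁).comp g)
  have hzero : γ.comp (LinearMap.lcomp k Y (i₂.comp q₁)) = 0 := by
    apply nuDuality_eq_zero
    rw [← nuMap_comp_nuDuality, hγ]
    ext y h
    have hcomp : ((h.comp i₂).comp q₁).comp i₁ = 0 := by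
      rw [LinearMap.comp_assoc, LinearMap.range_le_ker_iff.1 h₁.le, LinearMap.comp_zero]
    exact (congrArg (g y) hcomp).trans (map_zero _)
  obtain ⟨δ, hδ⟩ := exists_dual_comp_eq (LinearMap.lcomp k Y (i₁.comp q₀)) γ fun ψ hψ => by
    have hψ' : ∀ x, ψ (i₁ x) = 0 := fun x => by
      obtain ⟨p, rfl⟩ := hq₀ x
      exact LinearMap.congr_fun hψ p
    have hle : LinearMap.ker q₁ ≤ LinearMap.ker ψ := by
      rw [← h₁]
      rintro _ ⟨x, rfl⟩
      exact hψ' x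
    obtain ⟨ψ', rfl⟩ := exists_comp_eq_of_ker_le q₁ hq₁ ψ hle
    obtain ⟨χ, rfl⟩ := hext ψ'
    exact LinearMap.congr_fun hzero χ
  refine ⟨nuDuality k δ, LinearMap.ext fun y => nuMap_injective k i₁ hi₁ ?_⟩
  change _ = ((nuMap k i₁).comp g) y
  rw [← hγ, ← hδ]
  rfl

end NakayamaDuality

/-! ## Coresolutions by finitely generated projective-injective modules -/

section Coresolution

variable {A : Type} [Ring A]

variable (A) in
/-- A coresolution by finitely generated modules that are both projective and injective, cut into
short exact sequences `0 → M n → I n → M (n + 1) → 0`. -/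
structure CosyzygySeq where
  /-- the cosyzygies -/
  M : ℕ → ModuleCat.{0} A
  /-- the terms of the coresolution -/
  I : ℕ → ModuleCat.{0} A
  /-- the inclusions -/
  i : ∀ n, M n ⟶ I n
  /-- the projections -/
  q : ∀ n, I n ⟶ M (n + 1)
  injective_i : ∀ n, Function.Injective (i n)
  surjective_q : ∀ n, Function.Surjective (q n)
  range_eq_ker : ∀ n, LinearMap.range (i n).hom = LinearMap.ker (q n).hom
  finite_M : ∀ n, Module.Finite A (M n)
  finite_I : ∀ n, Module.Finite A (I n)
  projective_I : ∀ n, Module.Projective A (I n)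
  injective_I : ∀ n, Module.Injective A (I n)

lemma projective_of_module (P : ModuleCat.{0} A) [Module.Projective A P] : Projective P :=
  (IsProjective.iff_projective P).1 ‹_›

lemma injective_of_module (P : ModuleCat.{0} A) [Module.Injective A P] : Injective P :=
  Module.injective_object_of_injective_module A P

lemma exists_embedding (k : Type) [Field k] [Algebra k A] [FiniteDimensional k A]
    [Module.Injective A A] (N : ModuleCat.{0} A) [Module.Finite A N] :
    ∃ (P C : ModuleCat.{0} A) (i : N ⟶ P) (q : P ⟶ C), Function.Injective i ∧
      Function.Surjective q ∧ LinearMap.range i.hom = LinearMap.ker q.hom ∧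
      Module.Finite A C ∧ Module.Finite A P ∧ Module.Projective A P ∧ Module.Injective A P := by
  obtain ⟨n, g, hg⟩ := exists_injective_linearMap_fin (A := A) k N
  exact ⟨ModuleCat.of A (Fin n → A), ModuleCat.of A ((Fin n → A) ⧸ LinearMap.range g),
    ModuleCat.ofHom g, ModuleCat.ofHom (LinearMap.range g).mkQ, hg,
    Submodule.mkQ_surjective _, (Submodule.ker_mkQ _).symm,
    inferInstanceAs (Module.Finite A (_ ⧸ _)),
    inferInstanceAs (Module.Finite A (Fin n → A)),
    inferInstanceAs (Module.Projective A (Fin n → A)),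
    inferInstanceAs (Module.Injective A (Fin n → A))⟩

/-- A finitely generated injective module is projective. -/
lemma projective_of_injective (k : Type) [Field k] [Algebra k A] [FiniteDimensional k A]
    [Module.Injective A A] (N : Type) [AddCommGroup N] [Module A N] [Module.Finite A N]
    [Module.Injective A N] : Module.Projective A N := by
  obtain ⟨n, g, hg⟩ := exists_injective_linearMap_fin (A := A) k N
  obtain ⟨h, hh⟩ := Module.Injective.extension_property A _ _ _ g hg LinearMap.id
  exact Module.Projective.of_split g h hh

lemma exists_cosyzygySeq (k : Type) [Field k] [Algebra k A] [FiniteDimensional k A]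
    [Module.Injective A A] (N : ModuleCat.{0} A) [Module.Finite A N] :
    ∃ c : CosyzygySeq A, c.M 0 = N := by
  choose P C i q h₁ h₂ h₃ h₄ h₅ h₆ h₇ using
    fun X : {X : ModuleCat.{0} A // Module.Finite A X} =>
      have := X.2
      exists_embedding k X.1
  let s : ℕ → {X : ModuleCat.{0} A // Module.Finite A X} :=
    fun n => Nat.rec ⟨N, inferInstance⟩ (fun _ X => ⟨C X, h₄ X⟩) n
  exact ⟨⟨fun n => (s n).1, fun n => P (s n), fun n => i (s n), fun n => q (s n),
    fun n => h₁ _, fun n => h₂ _, fun n => h₃ _, fun n => (s n).2, fun n => h₅ _, fun n => h₆ _,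
    fun n => h₇ _⟩, rfl⟩

/-- Prepend a short exact sequence to a coresolution. -/
def CosyzygySeq.cons (c : CosyzygySeq A) {N P : ModuleCat.{0} A} (j : N ⟶ P) (r : P ⟶ c.M 0)
    (hj : Function.Injective j) (hr : Function.Surjective r)
    (hjr : LinearMap.range j.hom = LinearMap.ker r.hom) (h₁ : Module.Finite A N)
    (h₂ : Module.Finite A P) (h₃ : Module.Projective A P) (h₄ : Module.Injective A P) :
    CosyzygySeq A where
  M := fun | 0 => N | n + 1 => c.M n
  I := fun | 0 => P | n + 1 => c.I n
  i := fun | 0 => j | n + 1 => c.i n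
  q := fun | 0 => r | n + 1 => c.q n
  injective_i := fun | 0 => hj | n + 1 => c.injective_i n
  surjective_q := fun | 0 => hr | n + 1 => c.surjective_q n
  range_eq_ker := fun | 0 => hjr | n + 1 => c.range_eq_ker n
  finite_M := fun | 0 => h₁ | n + 1 => c.finite_M n
  finite_I := fun | 0 => h₂ | n + 1 => c.finite_I n
  projective_I := fun | 0 => h₃ | n + 1 => c.projective_I n
  injective_I := fun | 0 => h₄ | n + 1 => c.injective_I n

namespace CosyzygySeq

instance (c : CosyzygySeq A) (n : ℕ) : Module.Finite A (c.M n) := c.finite_M n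
instance (c : CosyzygySeq A) (n : ℕ) : Module.Finite A (c.I n) := c.finite_I n
instance (c : CosyzygySeq A) (n : ℕ) : Module.Projective A (c.I n) := c.projective_I n
instance (c : CosyzygySeq A) (n : ℕ) : Module.Injective A (c.I n) := c.injective_I n
instance (c : CosyzygySeq A) (n : ℕ) : Projective (c.I n) := projective_of_module _
instance (c : CosyzygySeq A) (n : ℕ) : Injective (c.I n) := injective_of_module _

/-- The short exact sequence `0 → M n → I n → M (n + 1) → 0`. -/
noncomputable def shortComplex (c : CosyzygySeq A) (n : ℕ) : ShortComplex (ModuleCat.{0} A) :=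
  ShortComplex.mk (c.i n) (c.q n)
    (ModuleCat.hom_ext (LinearMap.range_le_ker_iff.1 (c.range_eq_ker n).le))

lemma shortExact (c : CosyzygySeq A) (n : ℕ) : (c.shortComplex n).ShortExact :=
  shortExact_of_linearMap _ _ (c.injective_i n) (c.surjective_q n) (c.range_eq_ker n)

instance (c : CosyzygySeq A) (n : ℕ) : Projective (c.shortComplex n).X₂ :=
  inferInstanceAs (Projective (c.I n))
instance (c : CosyzygySeq A) (n : ℕ) : Injective (c.shortComplex n).X₂ :=
  inferInstanceAs (Injective (c.I n))

lemma orth_right (c : CosyzygySeq A) {C : ModuleCat.{0} A} {m n : ℕ} (hmn : m ≤ n)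
    (h : Orth C (c.M m)) : Orth C (c.M n) := by
  induction hmn with
  | refl => exact h
  | step _ ih => exact ih.cosyzygy_right (c.shortExact _)

lemma orth_self (c : CosyzygySeq A) (h : Orth (c.M 0) (c.M 0)) (n : ℕ) :
    Orth (c.M n) (c.M n) := by
  induction n with
  | zero => exact h
  | succ n ih => exact Orth.cosyzygy (c.shortExact n) (c.shortExact n) ih

/-- If all maps `M (n + 2) ⟶ Y` extend to `I (n + 2)`, then `Y` is orthogonal to `ν (M 0)`. -/
lemma orth_nuMod (k : Type) [Field k] [Algebra k A] [Module.Injective A A]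
    (c : CosyzygySeq A) {Y : ModuleCat.{0} A}
    (h : ∀ (n : ℕ) (g : c.M (n + 2) ⟶ Y), ∃ g' : c.I (n + 2) ⟶ Y, c.i (n + 2) ≫ g' = g) :
    Orth Y (NuMod k A (c.M 0)) := by
  let _ : Module k Y := Module.compHom Y (algebraMap k A)
  have : IsScalarTower k A Y := ⟨fun t a x => by
    rw [Algebra.smul_def, mul_smul]; rfl⟩
  let f (j : ℕ) : NuMod k A (c.M j) ⟶ NuMod k A (c.I j) := ModuleCat.ofHom (nuMap k (c.i j).hom)
  let g (j : ℕ) : NuMod k A (c.I j) ⟶ NuMod k A (c.M (j + 1)) :=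
    ModuleCat.ofHom (nuMap k (c.q j).hom)
  have hS (j : ℕ) := shortExact_of_linearMap (f j) (g j) (nuMap_injective k _ (c.injective_i j))
    (nuMap_surjective k _ (c.surjective_q j))
    (nuMap_range_eq_ker k _ _ (c.surjective_q j) (c.range_eq_ker j))
  have hinj (j : ℕ) : Injective (NuMod k A (c.I j)) :=
    have : Module.Injective A (NuMod k A (c.I j)) := injective_nuCarrier k
    injective_of_module _
  have key : ∀ n j : ℕ, Subsingleton (Abelian.Ext Y (NuMod k A (c.M j)) (n + 1)) := by
    intro n
    induction n with
    | zero =>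
      intro j
      have := hinj j
      refine subsingleton_ext_one_of_lift (hS j) fun u => ?_
      obtain ⟨g', hg'⟩ := exists_lift_nuMap k (c.q j).hom (c.surjective_q j) (c.i (j + 1)).hom
        (c.injective_i (j + 1)) (c.q (j + 1)).hom (c.surjective_q (j + 1))
        (c.range_eq_ker (j + 1)) (c.i (j + 2)).hom (fun v => by
          obtain ⟨v', hv'⟩ := h j (ModuleCat.ofHom v)
          exact ⟨v'.hom, congrArg ModuleCat.Hom.hom hv'⟩) u.hom
      exact ⟨ModuleCat.ofHom g', ModuleCat.hom_ext hg'⟩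
    | succ n ih =>
      intro j
      have := hinj j
      exact subsingleton_ext_of_cosyzygy (hS j) n (ih (j + 1))
  exact fun n => key n 0

end CosyzygySeq

lemma Orth.of_nakayamaStable {k : Type} [Field k] [Algebra k A] {M Y : ModuleCat.{0} A}
    (hM : NakayamaStable k A M)
    (h : Orth Y (NuMod k A M)) : Orth Y M := by
  have hself : MemAdd A M M := ⟨1, ModuleCat.of A PUnit,
    ⟨(LinearEquiv.prodUnique).trans (LinearEquiv.funUnique (Fin 1) A M).symm⟩⟩
  obtain ⟨n, Z, ⟨e⟩⟩ := (hM M).1 hself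
  refine Orth.of_sum (ι := Fin n)
    (fun i => ModuleCat.ofHom (LinearMap.proj i ∘ₗ e.toLinearMap ∘ₗ LinearMap.inl A M Z))
    (fun i => ModuleCat.ofHom (LinearMap.fst A M Z ∘ₗ e.symm.toLinearMap ∘ₗ
      LinearMap.single A (fun _ => NuMod k A M) i)) ?_ h
  ext x
  have h1 := LinearMap.sum_single_apply (fun _ : Fin n => NuMod k A M) (e (x, 0))
  have h2 := congrArg (fun y => (e.symm y).1) h1
  simp only [map_sum, Prod.fst_sum, LinearEquiv.symm_apply_apply] at h2
  simpa [ModuleCat.hom_sum] using h2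

end Coresolution

/-! ## A tower of extensions -/

section Pushout

variable {A : Type} [Ring A]

lemma exists_pushout {N P Q X : ModuleCat.{0} A} (φ : N ⟶ X) (i : N ⟶ P) (q : P ⟶ Q)
    (hi : Function.Injective i) (hq : Function.Surjective q)
    (hiq : LinearMap.range i.hom = LinearMap.ker q.hom)
    [Module.Finite A X] [Module.Finite A P] :
    ∃ (X' : ModuleCat.{0} A) (f : X ⟶ X') (h : P ⟶ X') (r : X' ⟶ Q), Module.Finite A X' ∧
      Function.Injective f ∧ Function.Surjective r ∧
      LinearMap.range f.hom = LinearMap.ker r.hom ∧ φ ≫ f = i ≫ h := by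
  let R : Submodule A (X × P) := LinearMap.range (φ.hom.prod (-i.hom))
  have hqi : ∀ x, q (i x) = 0 := fun x => by
    have : i.hom x ∈ LinearMap.ker q.hom := hiq ▸ LinearMap.mem_range_self _ x
    exact this
  have hR : R ≤ LinearMap.ker (q.hom ∘ₗ LinearMap.snd A X P) := by
    rintro _ ⟨x, rfl⟩
    simp [hqi]
  let f : X →ₗ[A] (X × P) ⧸ R := R.mkQ ∘ₗ LinearMap.inl A X P
  let h : P →ₗ[A] (X × P) ⧸ R := R.mkQ ∘ₗ LinearMap.inr A X P
  let r : ((X × P) ⧸ R) →ₗ[A] Q := R.liftQ (q.hom ∘ₗ LinearMap.snd A X P) hR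
  refine ⟨ModuleCat.of A ((X × P) ⧸ R), ModuleCat.ofHom f, ModuleCat.ofHom h, ModuleCat.ofHom r,
    inferInstanceAs (Module.Finite A ((X × P) ⧸ R)), ?_, ?_, ?_, ?_⟩
  · change Function.Injective f
    rw [injective_iff_map_eq_zero]
    intro x hx
    obtain ⟨y, hy⟩ := (Submodule.Quotient.mk_eq_zero R).1 hx
    have hy2 : -i y = 0 := congrArg Prod.snd hy
    have : y = 0 := hi (by rw [map_zero]; exact neg_eq_zero.1 hy2)
    have hy1 : φ y = x := congrArg Prod.fst hy
    rw [← hy1, this, map_zero]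
  · intro c
    obtain ⟨p, rfl⟩ := hq c
    exact ⟨h p, rfl⟩
  · change LinearMap.range f = LinearMap.ker r
    apply le_antisymm
    · rintro _ ⟨x, rfl⟩
      exact map_zero q.hom
    · intro z hz
      obtain ⟨⟨x, p⟩, rfl⟩ := R.mkQ_surjective z
      have hp : p ∈ LinearMap.range i.hom := hiq ▸ hz
      obtain ⟨y, rfl⟩ := hp
      refine ⟨x + φ y, (Submodule.Quotient.eq R).2 ⟨y, ?_⟩⟩
      simp
  · ext x
    exact (Submodule.Quotient.eq R).2 ⟨x, by simp; exact ⟨rfl, rfl⟩⟩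

lemma Orth.fin_pow {C N : ModuleCat.{0} A} (h : Orth C N) (d : ℕ) :
    Orth C (ModuleCat.of A (Fin d → N)) := by
  refine Orth.of_sum (ι := Fin d) (fun i => ModuleCat.ofHom (LinearMap.proj i))
    (fun i => ModuleCat.ofHom (LinearMap.single A (fun _ => N) i)) ?_ h
  ext x
  simp [ModuleCat.hom_sum]

lemma exists_spanning_family (k : Type) [Field k] [Algebra k A] [FiniteDimensional k A]
    {N X : Type} [AddCommGroup N] [Module A N] [AddCommGroup X] [Module A X] [Module.Finite A N]
    [Module.Finite A X] [Module k N] [IsScalarTower k A N] [Module k X] [IsScalarTower k A X] :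
    ∃ (d : ℕ) (g : Fin d → (N →ₗ[A] X)), ∀ g₀ : N →ₗ[A] X, ∃ t : Fin d → k,
      g₀ = ∑ l, t l • g l := by
  have : Module.Finite k N := Module.Finite.trans A N
  have : Module.Finite k X := Module.Finite.trans A X
  have : Module.Finite k (N →ₗ[A] X) :=
    Module.Finite.of_injective (LinearMap.restrictScalarsₗ k A N X k)
      (LinearMap.restrictScalars_injective k)
  obtain ⟨d, g, hg⟩ := Module.Finite.exists_fin (R := k) (M := N →ₗ[A] X)
  refine ⟨d, g, fun g₀ => ?_⟩
  obtain ⟨t, ht⟩ := (Submodule.mem_span_range_iff_exists_fun k).1 (hg ▸ Submodule.mem_top : g₀ ∈ _)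
  exact ⟨t, ht.symm⟩

lemma exists_extending_extension (k : Type) [Field k] [Algebra k A] [FiniteDimensional k A]
    (c : CosyzygySeq A) (j : ℕ) (X : ModuleCat.{0} A) [Module.Finite A X] :
    ∃ (X' Q : ModuleCat.{0} A) (f : X ⟶ X') (r : X' ⟶ Q), Module.Finite A X' ∧
      Function.Injective f ∧ Function.Surjective r ∧
      LinearMap.range f.hom = LinearMap.ker r.hom ∧
      (∀ C : ModuleCat.{0} A, Orth C (c.M (j + 1)) → Orth C Q) ∧
      ∀ g : c.M j ⟶ X, ∃ g' : c.I j ⟶ X', c.i j ≫ g' = g ≫ f := by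
  let _ : Module k X := Module.compHom X (algebraMap k A)
  let _ : Module k (c.M j) := Module.compHom (c.M j) (algebraMap k A)
  have : IsScalarTower k A X := ⟨fun t a x => by
    rw [Algebra.smul_def, mul_smul]; rfl⟩
  have : IsScalarTower k A (c.M j) := ⟨fun t a x => by
    rw [Algebra.smul_def, mul_smul]; rfl⟩
  let _ : Module k (c.I j) := Module.compHom (c.I j) (algebraMap k A)
  have : IsScalarTower k A (c.I j) := ⟨fun t a x => by
    rw [Algebra.smul_def, mul_smul]; rfl⟩
  obtain ⟨d, g, hg⟩ := exists_spanning_family (A := A) k (N := c.M j) (X := X)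
  let φ : (Fin d → c.M j) →ₗ[A] X := ∑ l, (g l) ∘ₗ LinearMap.proj l
  let i : (Fin d → c.M j) →ₗ[A] (Fin d → c.I j) := (c.i j).hom.compLeft (Fin d)
  let q : (Fin d → c.I j) →ₗ[A] (Fin d → c.M (j + 1)) := (c.q j).hom.compLeft (Fin d)
  have : Module.Finite A (ModuleCat.of A (Fin d → c.I j)) :=
    inferInstanceAs (Module.Finite A (Fin d → c.I j))
  obtain ⟨X', f, h, r, hfin, hf, hr, hfr, hcomm⟩ := exists_pushout (ModuleCat.ofHom φ)
    (ModuleCat.ofHom i) (ModuleCat.ofHom q) (fun x y hxy => funext fun l =>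
      c.injective_i j (congrFun hxy l))
    (fun y => ⟨fun l => (c.surjective_q j (y l)).choose, funext fun l =>
      (c.surjective_q j (y l)).choose_spec⟩) (by
      ext p
      change (∃ x, _) ↔ _ = (0 : Fin d → c.M (j + 1))
      have hmem : ∀ y, (∃ x, (c.i j).hom x = y) ↔ (c.q j).hom y = 0 := fun y =>
        SetLike.ext_iff.1 (c.range_eq_ker j) y
      simp only [funext_iff]
      exact (Classical.skolem (p := fun l x => (c.i j).hom x = p l)).symm.trans
        (forall_congr' fun l => hmem (p l)))
  refine ⟨X', _, f, r, hfin, hf, hr, hfr, fun C hC => hC.fin_pow d, fun g₀ => ?_⟩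
  obtain ⟨t, ht⟩ := hg g₀.hom
  let s : c.I j →ₗ[A] (Fin d → c.I j) := LinearMap.pi fun l => t l • LinearMap.id
  let s' : c.M j →ₗ[A] (Fin d → c.M j) := LinearMap.pi fun l => t l • LinearMap.id
  refine ⟨ModuleCat.ofHom s ≫ h, ?_⟩
  have h1 : c.i j ≫ ModuleCat.ofHom s = ModuleCat.ofHom s' ≫ ModuleCat.ofHom i := by
    ext x l
    exact (map_smul (c.i j).hom (algebraMap k A (t l)) x).symm
  have h2 : ModuleCat.ofHom s' ≫ ModuleCat.ofHom φ = g₀ := by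
    ext x
    rw [ht]
    simp [φ, s']
  rw [← Category.assoc, h1, Category.assoc, ← hcomm, ← Category.assoc, h2]

end Pushout

section Tower

variable {A : Type} [Ring A]

/-- An increasing union of modules `X 0 ⊆ X 1 ⊆ ⋯`, starting at the first cosyzygy `c.M 1`, with
subquotients `Q n`, such that every map from a cosyzygy `c.M (j + 2)` to some `X n` extends
to `c.I (j + 2)` at a later stage. -/
structure ExtensionTower (c : CosyzygySeq A) where
  /-- the stages -/
  X : ℕ → ModuleCat.{0} A
  /-- the subquotients -/
  Q : ℕ → ModuleCat.{0} A
  /-- the inclusions -/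
  f : ∀ n, X n ⟶ X (n + 1)
  /-- the projections -/
  r : ∀ n, X (n + 1) ⟶ Q n
  /-- the first stage -/
  e : c.M 1 ≅ X 0
  injective_f : ∀ n, Function.Injective (f n)
  surjective_r : ∀ n, Function.Surjective (r n)
  range_eq_ker : ∀ n, LinearMap.range (f n).hom = LinearMap.ker (r n).hom
  orth_Q : ∀ (n : ℕ) (C : ModuleCat.{0} A), Orth C (c.M 3) → Orth C (Q n)
  exists_extend : ∀ (n : ℕ) (g : c.M (n.unpair.1 + 2) ⟶ X n),
    ∃ g' : c.I (n.unpair.1 + 2) ⟶ X (n + 1), c.i _ ≫ g' = g ≫ f n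

lemma nonempty_extensionTower (k : Type) [Field k] [Algebra k A] [FiniteDimensional k A]
    (c : CosyzygySeq A) : Nonempty (ExtensionTower c) := by
  choose X' Q f r h₁ h₂ h₃ h₄ h₅ h₆ using
    fun (n : ℕ) (X : {X : ModuleCat.{0} A // Module.Finite A X}) =>
      have := X.2
      exists_extending_extension k c (n.unpair.1 + 2) X.1
  let s : ℕ → {X : ModuleCat.{0} A // Module.Finite A X} :=
    fun n => Nat.rec ⟨c.M 1, inferInstance⟩ (fun n X => ⟨X' n X, h₁ n X⟩) n
  exact ⟨⟨fun n => (s n).1, fun n => Q n (s n), fun n => f n (s n), fun n => r n (s n), Iso.refl _,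
    fun n => h₂ _ _, fun n => h₃ _ _, fun n => h₄ _ _,
    fun n C hC => h₅ _ _ C (c.orth_right (by omega) hC), fun n => h₆ n (s n)⟩⟩

lemma exists_sequential_union (X : ℕ → ModuleCat.{0} A) (f : ∀ n, X n ⟶ X (n + 1))
    (hf : ∀ n, Function.Injective (f n)) :
    ∃ (W : ModuleCat.{0} A) (a : ∀ n, X n ⟶ W), (∀ n, f n ≫ a (n + 1) = a n) ∧
      (∀ n, Function.Injective (a n)) ∧ ∀ w : W, ∃ n x, a n x = w := by
  let F := Functor.ofSequence f
  have hF : ∀ {m n : ℕ} (u : m ⟶ n), Function.Injective (F.map u) := by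
    intro m n u
    obtain ⟨d, rfl⟩ := Nat.exists_eq_add_of_le (leOfHom u)
    induction d with
    | zero =>
      rw [Subsingleton.elim u (𝟙 _), F.map_id]
      exact Function.injective_id
    | succ d ih =>
      rw [Subsingleton.elim u (homOfLE (by omega) ≫ homOfLE (Nat.le_succ (m + d))), F.map_comp,
        Functor.ofSequence_map_homOfLE_succ]
      exact (hf _).comp (ih _)
  refine ⟨Limits.colimit F, fun n => Limits.colimit.ι F n, fun n => ?_, fun n x y hxy => ?_,
    fun w => Limits.Concrete.colimit_exists_rep F w⟩
  · have h := Limits.colimit.w F (homOfLE (Nat.le_succ n))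
    rw [Functor.ofSequence_map_homOfLE_succ] at h
    exact h
  · obtain ⟨m, u, v, huv⟩ := Limits.Concrete.colimit_exists_of_rep_eq F x y hxy
    rw [Subsingleton.elim v u] at huv
    exact hF u huv

lemma exists_factor_of_union {X : ℕ → ModuleCat.{0} A} {f : ∀ n, X n ⟶ X (n + 1)}
    {W : ModuleCat.{0} A} {a : ∀ n, X n ⟶ W} (ha : ∀ n, f n ≫ a (n + 1) = a n)
    (hinj : ∀ n, Function.Injective (a n)) (hsurj : ∀ w : W, ∃ n x, a n x = w)
    {L : ModuleCat.{0} A} [Module.Finite A L] (g : L ⟶ W) :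
    ∃ (n : ℕ) (g' : L ⟶ X n), g' ≫ a n = g := by
  have hmono : Monotone fun n => LinearMap.range (a n).hom := by
    refine monotone_nat_of_le_succ fun n => ?_
    rw [← ha n]
    exact LinearMap.range_comp_le_range _ _
  have htop : ⨆ n, LinearMap.range (a n).hom = ⊤ := by
    rw [eq_top_iff]
    intro w _
    obtain ⟨n, x, rfl⟩ := hsurj w
    exact Submodule.mem_iSup_of_mem n ⟨x, rfl⟩
  have hfg : (LinearMap.range g.hom).FG := Module.Finite.iff_fg.1 inferInstance
  obtain ⟨n, hn⟩ : ∃ n, LinearMap.range g.hom ≤ LinearMap.range (a n).hom := by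
    rw [Submodule.fg_iff_compact, CompleteLattice.isCompactElement_iff_exists_le_iSup_of_le_iSup]
      at hfg
    obtain ⟨s, hs⟩ := hfg ℕ (fun n => LinearMap.range (a n).hom) (htop ▸ le_top)
    refine ⟨s.sup id, hs.trans (Finset.sup_le fun n hn => hmono (Finset.le_sup (f := id) hn))⟩
  refine ⟨n, ModuleCat.ofHom ((LinearEquiv.ofInjective (a n).hom (hinj n)).symm.toLinearMap ∘ₗ
    g.hom.codRestrict _ fun x => hn ⟨x, rfl⟩), ?_⟩
  ext x
  exact congrArg Subtype.val ((LinearEquiv.ofInjective (a n).hom (hinj n)).apply_symm_apply _)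

lemma exists_syzygy [IsNoetherianRing A] (L : ModuleCat.{0} A) [Module.Finite A L] :
    ∃ S : ShortComplex (ModuleCat.{0} A), S.ShortExact ∧ S.X₃ = L ∧ Module.Finite A S.X₁ ∧
      Projective S.X₂ := by
  obtain ⟨s, p, hp⟩ := Module.Finite.exists_fin' A L
  exact ⟨_, shortExact_of_linearMap (ModuleCat.ofHom (LinearMap.ker p).subtype)
    (ModuleCat.ofHom p) (Submodule.injective_subtype _) hp (Submodule.range_subtype _), rfl,
    inferInstanceAs (Module.Finite A (LinearMap.ker p)),
    projective_of_module (ModuleCat.of A (Fin s → A))⟩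

lemma subsingleton_ext_of_union [IsNoetherianRing A] {X : ℕ → ModuleCat.{0} A}
    {W : ModuleCat.{0} A} (a : ∀ n, X n ⟶ W)
    (hfac : ∀ (L : ModuleCat.{0} A) [Module.Finite A L] (g : L ⟶ W),
      ∃ (n : ℕ) (g' : L ⟶ X n), g' ≫ a n = g) (n : ℕ) (L : ModuleCat.{0} A) [Module.Finite A L]
    (h : ∀ m, Subsingleton (Abelian.Ext L (X m) (n + 1))) :
    Subsingleton (Abelian.Ext L W (n + 1)) := by
  obtain ⟨S, hS, rfl, _, _⟩ := exists_syzygy L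
  induction n generalizing S with
  | zero =>
    refine subsingleton_ext_one_of_extension hS fun g => ?_
    obtain ⟨m, g', rfl⟩ := hfac _ g
    obtain ⟨u, hu⟩ := exists_extension_of_subsingleton_ext hS (h m) g'
    exact ⟨u ≫ a m, by rw [← hu, Category.assoc]⟩
  | succ n ih =>
    obtain ⟨T, hT, hTS, _, _⟩ := exists_syzygy S.X₁
    have : Module.Finite A T.X₃ := hTS ▸ inferInstance
    refine subsingleton_ext_of_syzygy hS n (hTS ▸ ih T hT (fun m => ?_) ‹_› ‹_›)
    rw [hTS]
    exact subsingleton_ext_syzygy hS n (h m)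

end Tower

namespace ExtensionTower

variable {A : Type} [Ring A] {c : CosyzygySeq A}

lemma shortExact (t : ExtensionTower c) (n : ℕ) :
    (ShortComplex.mk (t.f n) (t.r n)
      (ModuleCat.hom_ext (LinearMap.range_le_ker_iff.1 (t.range_eq_ker n).le))).ShortExact :=
  shortExact_of_linearMap _ _ (t.injective_f n) (t.surjective_r n) (t.range_eq_ker n)

lemma orth_stage (t : ExtensionTower c) {C : ModuleCat.{0} A} (h : Orth C (c.M 1)) (n : ℕ) :
    Orth C (t.X n) := by
  induction n with
  | zero => exact Orth.of_sum (ι := Unit) (fun _ => t.e.inv) (fun _ => t.e.hom) (by simp) h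
  | succ n ih => exact ih.middle (t.shortExact n) (t.orth_Q n C (c.orth_right (by omega) h))

/-- The inclusion of the first cosyzygy in a stage. -/
def base (t : ExtensionTower c) : ∀ n, c.M 1 ⟶ t.X n
  | 0 => t.e.hom
  | n + 1 => t.base n ≫ t.f n

lemma base_comp (t : ExtensionTower c) {W : ModuleCat.{0} A} {a : ∀ n, t.X n ⟶ W}
    (ha : ∀ n, t.f n ≫ a (n + 1) = a n) (n : ℕ) : t.base n ≫ a n = t.e.hom ≫ a 0 := by
  induction n with
  | zero => rfl
  | succ n ih => rw [base, Category.assoc, ha, ih]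

lemma exists_transition (t : ExtensionTower c) {W : ModuleCat.{0} A} {a : ∀ n, t.X n ⟶ W}
    (ha : ∀ n, t.f n ≫ a (n + 1) = a n) {m n : ℕ} (hmn : m ≤ n) :
    ∃ u : t.X m ⟶ t.X n, u ≫ a n = a m := by
  induction hmn with
  | refl => exact ⟨𝟙 _, Category.id_comp _⟩
  | step _ ih =>
    obtain ⟨u, hu⟩ := ih
    exact ⟨u ≫ t.f _, by rw [Category.assoc, ha, hu]⟩

/-- If the inclusion of the first cosyzygy in some stage extends to its injective hull, then that
cosyzygy is a retract of its hull. -/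
lemma exists_retraction (t : ExtensionTower c) (h : Orth (c.M 0) (c.M 0)) (n : ℕ)
    (u : c.I 1 ⟶ t.X n) (hu : c.i 1 ≫ u = t.base n) : ∃ r : c.I 1 ⟶ c.M 1, c.i 1 ≫ r = 𝟙 _ := by
  induction n with
  | zero => exact ⟨u ≫ t.e.inv, by rw [reassoc_of% hu, base, Iso.hom_inv_id]⟩
  | succ n ih =>
    have hS := t.shortExact n
    have hc := c.shortExact 1
    have := hc.epi_g
    have hfr : t.f n ≫ t.r n = 0 :=
      ModuleCat.hom_ext (LinearMap.range_le_ker_iff.1 (t.range_eq_ker n).le)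
    have hiq : c.i 1 ≫ c.q 1 = 0 := (c.shortComplex 1).zero
    have hzero : c.i 1 ≫ u ≫ t.r n = 0 := by
      rw [reassoc_of% hu, base, Category.assoc, hfr, Limits.comp_zero]
    have hv : c.q 1 ≫ hc.exact.desc (u ≫ t.r n) hzero = u ≫ t.r n := hc.exact.g_desc _ _
    obtain ⟨v, hv'⟩ := exists_extension_of_subsingleton_ext (c.shortExact 2)
      (t.orth_Q n (c.M 3) (c.orth_self h 3) 0) (hc.exact.desc (u ≫ t.r n) hzero)
    have : Epi (t.r n) := hS.epi_g
    have : Mono (t.f n) := hS.mono_f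
    have hw : Projective.factorThru (P := c.I 2) v (t.r n) ≫ t.r n = v :=
      Projective.factorThru_comp _ _
    have hv'' : c.i 2 ≫ v = hc.exact.desc (u ≫ t.r n) hzero := hv'
    have hk : (u - c.q 1 ≫ c.i 2 ≫ Projective.factorThru (P := c.I 2) v (t.r n)) ≫ t.r n = 0 := by
      rw [Preadditive.sub_comp, Category.assoc, Category.assoc, hw, hv'', hv, sub_self]
    refine ih (hS.exact.lift _ hk) ?_
    rw [← cancel_mono (t.f n), Category.assoc]
    refine (congrArg (c.i 1 ≫ ·) (hS.exact.lift_f _ hk)).trans ?_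
    rw [Preadditive.comp_sub, reassoc_of% hiq, Limits.zero_comp, sub_zero, hu, base]

lemma memG_union {k : Type} [Field k] [Algebra k A] [FiniteDimensional k A] [Module.Injective A A]
    (t : ExtensionTower c) (h : Orth (c.M 0) (c.M 0)) (hns : NakayamaStable k A (c.M 0))
    {W : ModuleCat.{0} A} {a : ∀ n, t.X n ⟶ W} (ha : ∀ n, t.f n ≫ a (n + 1) = a n)
    (hinj : ∀ n, Function.Injective (a n)) (hsurj : ∀ w : W, ∃ n x, a n x = w) :
    MemG A (c.M 0) W := by
  have : IsNoetherianRing A := IsNoetherianRing.of_finite k A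
  refine memG_iff.2 ⟨fun n => subsingleton_ext_of_union a
    (fun L _ g => exists_factor_of_union ha hinj hsurj g) n _
    fun m => t.orth_stage (c.orth_right (by omega) h) m n,
    Orth.of_nakayamaStable hns (c.orth_nuMod k fun j g => ?_)⟩
  obtain ⟨n, g', rfl⟩ := exists_factor_of_union ha hinj hsurj g
  obtain ⟨u, hu⟩ := t.exists_transition ha (Nat.right_le_pair j n)
  obtain ⟨v, hv⟩ : ∃ v : c.I (j + 2) ⟶ t.X (Nat.pair j n + 1),
      c.i (j + 2) ≫ v = (g' ≫ u) ≫ t.f (Nat.pair j n) := by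
    have := t.exists_extend (Nat.pair j n)
    rw [Nat.unpair_pair] at this
    exact this (g' ≫ u)
  exact ⟨v ≫ a _, by rw [reassoc_of% hv, ha, hu]⟩

end ExtensionTower

section FilteredColimit

variable {A : Type} [Ring A]

lemma exists_factor_of_isColimit [IsNoetherianRing A] {J : Type} [SmallCategory J] [IsFiltered J]
    {F : J ⥤ ModuleCat.{0} A} {D : Limits.Cocone F} (hD : Limits.IsColimit D)
    {L : ModuleCat.{0} A} [Module.Finite A L] (g : L ⟶ D.pt) :
    ∃ (j : J) (g' : L ⟶ F.obj j), g' ≫ D.ι.app j = g := by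
  classical
  obtain ⟨s, p, hp⟩ := Module.Finite.exists_fin' A L
  have hD' (j : J) (j' : J) (u : j ⟶ j') (x : F.obj j) :
      D.ι.app j' (F.map u x) = D.ι.app j x := by
    rw [← D.w u]
    rfl
  obtain ⟨j₀, y, hy⟩ : ∃ (j : J) (y : Fin s → F.obj j),
      ∀ i, D.ι.app j (y i) = g (p (Pi.single i 1)) := by
    choose d z hz using fun i => Limits.Concrete.isColimit_exists_rep F hD (g (p (Pi.single i 1)))
    obtain ⟨j, hj⟩ := IsFiltered.sup_objs_exists (Finset.univ.image d)
    have u (i : Fin s) : d i ⟶ j := (hj (Finset.mem_image_of_mem d (Finset.mem_univ i))).some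
    exact ⟨j, fun i => F.map (u i) (z i), fun i => by rw [hD']; exact hz i⟩
  have hkill (T : Finset (Fin s → A)) (hT : ∀ x ∈ T, p x = 0) :
      ∃ (j : J) (h : (Fin s → A) →ₗ[A] F.obj j),
        (D.ι.app j).hom ∘ₗ h = g.hom ∘ₗ p ∧ ∀ x ∈ T, h x = 0 := by
    induction T using Finset.induction_on with
    | empty =>
      refine ⟨j₀, (Pi.basisFun A (Fin s)).constr ℕ y, (Pi.basisFun A (Fin s)).ext fun i => ?_,
        by simp⟩
      rw [LinearMap.comp_apply, Module.Basis.constr_basis]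
      simpa using hy i
    | insert x T _ ih =>
      obtain ⟨j, h, hcomp, hker⟩ := ih fun x hx => hT x (Finset.mem_insert_of_mem hx)
      have hx : D.ι.app j (h x) = D.ι.app j 0 := by
        rw [map_zero]
        refine (LinearMap.congr_fun hcomp x).trans ?_
        rw [LinearMap.comp_apply, hT x (Finset.mem_insert_self x T), map_zero]
      obtain ⟨j', u, v, huv⟩ := Limits.Concrete.isColimit_exists_of_rep_eq F hD _ _ hx
      refine ⟨j', (F.map u).hom ∘ₗ h, ?_, fun z hz => ?_⟩
      · rw [← hcomp]
        ext1
        exact LinearMap.ext fun _ => hD' _ _ _ _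
      · obtain rfl | hz := Finset.mem_insert.1 hz
        · exact huv.trans (map_zero (F.map v).hom)
        · rw [LinearMap.comp_apply, hker z hz, map_zero]
  obtain ⟨T, hT⟩ : (LinearMap.ker p).FG := IsNoetherian.noetherian _
  obtain ⟨j, h, hcomp, hker⟩ := hkill T fun x hx => by
    have : x ∈ LinearMap.ker p := hT ▸ Submodule.subset_span hx
    exact this
  obtain ⟨h', rfl⟩ := exists_comp_eq_of_ker_le p hp h
    (hT ▸ Submodule.span_le.2 fun x hx => hker x hx)
  refine ⟨j, ModuleCat.ofHom h', ModuleCat.hom_ext (LinearMap.ext fun x => ?_)⟩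
  obtain ⟨x, rfl⟩ := hp x
  exact LinearMap.congr_fun hcomp x

end FilteredColimit

section Main

variable {A : Type} [Ring A]

/-- If the universal extension of the first cosyzygy factors through a finitely generated module in
`𝒢`, then `c.M 0` is projective. -/
lemma ExtensionTower.projective_of_factor (k : Type) [Field k] [Algebra k A] [FiniteDimensional k A]
    [Module.Injective A A] {c : CosyzygySeq A} (t : ExtensionTower c)
    (h : Orth (c.M 0) (c.M 0)) {G : ModuleCat.{0} A} [Module.Finite A G] (hG : Orth G (c.M 0))
    {n : ℕ} (u : c.M 1 ⟶ G) (v : G ⟶ t.X n) (huv : u ≫ v = t.base n) :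
    Module.Projective A (c.M 0) := by
  obtain ⟨P, C, i, q, hi, hq, hiq, _, _, _, _⟩ := exists_embedding k G
  have hS := shortExact_of_linearMap i q hi hq hiq
  have : Projective P := projective_of_module P
  have : Injective P := injective_of_module P
  have hC : Orth C (c.M 1) := Orth.cosyzygy hS (c.shortExact 0) hG
  obtain ⟨v', hv'⟩ := exists_extension_of_subsingleton_ext hS (t.orth_stage hC n 0) v
  have : Mono (c.i 1) := (c.shortExact 1).mono_f
  have hi' : c.i 1 ≫ Injective.factorThru (u ≫ i) (c.i 1) = u ≫ i := Injective.comp_factorThru _ _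
  obtain ⟨r, hr⟩ := t.exists_retraction h n (Injective.factorThru (u ≫ i) (c.i 1) ≫ v') (by
    rw [reassoc_of% hi', ← huv, ← hv'])
  have : Module.Injective A (c.M 1) := by
    have : Injective (c.M 1) := (Retract.mk (c.i 1) r hr).injective
    exact Module.injective_module_of_injective_object A (c.M 1)
  have : Module.Projective A (c.M 1) := projective_of_injective k _
  obtain ⟨s, hs⟩ := exists_extension_of_subsingleton_ext (c.shortExact 0)
    (have := projective_of_module (c.M 1); orth_of_projective (c.M 1) (c.M 0) 0) (𝟙 _)
  exact Module.Projective.of_split (c.i 0).hom s.hom (congrArg ModuleCat.Hom.hom hs)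

/-- The injective envelope of a finitely generated module is finitely generated. -/
lemma finite_of_isInjEnvelope (k : Type) [Field k] [Algebra k A] [FiniteDimensional k A]
    [Module.Injective A A] {M I : ModuleCat.{0} A} [Module.Finite A M] {ι : M ⟶ I}
    (hι : IsInjEnvelope A ι) : Module.Finite A I := by
  have : IsNoetherianRing A := IsNoetherianRing.of_finite k A
  obtain ⟨n, g, hg⟩ := exists_injective_linearMap_fin (A := A) k M
  obtain ⟨h, hh⟩ := Module.Injective.extension_property A _ _ _ ι.hom hι.2.1 g
  refine Module.Finite.of_injective h (LinearMap.ker_eq_bot.1 (hι.2.2 _ ?_))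
  rw [eq_bot_iff]
  rintro _ ⟨hx, m, rfl⟩
  have : g m = 0 := (LinearMap.congr_fun hh m).symm.trans hx
  rw [(map_eq_zero_iff g hg).1 this, map_zero]
  exact zero_mem _

lemma IsInjEnvelope.surjective {M I : ModuleCat.{0} A} [Module.Injective A M] {ι : M ⟶ I}
    (hι : IsInjEnvelope A ι) : Function.Surjective ι := by
  obtain ⟨r, hr⟩ := Module.Injective.extension_property A _ _ _ ι.hom hι.2.1 LinearMap.id
  have hr' (m : M) : r (ι.hom m) = m := LinearMap.congr_fun hr m
  have hinj : Function.Injective r := LinearMap.ker_eq_bot.1 (hι.2.2 _ (by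
    rw [eq_bot_iff]
    rintro _ ⟨hx, m, rfl⟩
    have : m = 0 := (hr' m).symm.trans hx
    rw [this, map_zero]
    exact zero_mem _))
  exact fun x => ⟨r x, hinj (hr' (r x))⟩

lemma injective_of_projective [Module.Injective A A] (N : Type)
    [AddCommGroup N] [Module A N] [Module.Finite A N]
    [Module.Projective A N] : Module.Injective A N := by
  obtain ⟨n, p, hp⟩ := Module.Finite.exists_fin' A N
  obtain ⟨s, hs⟩ := Module.projective_lifting_property p LinearMap.id hp
  have hr : ModuleCat.ofHom s ≫ ModuleCat.ofHom p = 𝟙 (ModuleCat.of A N) := ModuleCat.hom_ext hs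
  have : Injective (ModuleCat.of A (Fin n → A)) := injective_of_module _
  have := (Retract.mk _ _ hr).injective
  exact Module.injective_module_of_injective_object A N

end Main

/-- **Theorem 1.2, (1) ⇔ (4)**. Let `0 → M → I → Ω` be exact with `M ⟶ I` an injective
envelope (so that `Ω = Ω_A^{-1}(M)`), and let `f : Ω ⟶ W` be a minimal left
`𝒢`-approximation. Then `M` is projective iff `W` is a filtered colimit of finitely
generated modules lying in `𝒢`. -/
theorem tachikawa_second_conjecture_iff_approximation_filtered_colimit
    (k A : Type) [Field k] [Ring A] [Algebra k A] [FiniteDimensional k A]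
    [Module.Injective A A]
    (M : ModuleCat.{0} A) [Module.Finite A ↥M]
    (hgen : IsGen A M) (hso : SelfOrthogonal A M) (hns : NakayamaStable k A M)
    (I Om W : ModuleCat.{0} A) (ι : M ⟶ I) (p : I ⟶ Om)
    (hι : IsInjEnvelope A ι) (hp : Function.Surjective p)
    (hex : LinearMap.range ι.hom = LinearMap.ker p.hom)
    (f : Om ⟶ W) (happrox : IsLeftGApprox A M f) (hmin : LeftMinimal A f) :
    Module.Projective A ↥M ↔ FiltColimOfFgG A M W := by
  have : IsNoetherianRing A := IsNoetherianRing.of_finite k A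
  refine ⟨fun _ => ?_, ?_⟩
  · have : Module.Injective A M := injective_of_projective M
    have hp0 (y : Om) : y = 0 := by
      obtain ⟨x, rfl⟩ := hp y
      have hx : x ∈ LinearMap.range ι.hom := hι.surjective x
      rw [hex] at hx
      exact hx
    have hf : f = 0 := by
      ext y
      rw [hp0 y, map_zero, map_zero]
    have hα := (hmin 0 (by rw [hf, Limits.zero_comp])).1
    have : Subsingleton W := ⟨fun x y => hα rfl⟩
    have hW : Module.Finite A W := inferInstance
    exact ⟨Cat.of (Discrete PUnit), inferInstanceAs (IsFiltered (Discrete PUnit)),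
      Functor.fromPUnit W, ⟨W, { app := fun _ => 𝟙 W }⟩, fun _ => ⟨hW, happrox.1⟩,
      ⟨{ desc := fun s => s.ι.app ⟨⟨⟩⟩
         fac := fun s j => Category.id_comp _
         uniq := fun s m hm => (Category.id_comp m).symm.trans (hm ⟨⟨⟩⟩) }⟩, ⟨Iso.refl W⟩⟩
  · rintro ⟨J, _, F, D, hF, ⟨hD⟩, ⟨e⟩⟩
    have : Module.Finite A I := finite_of_isInjEnvelope k hι
    have : Module.Injective A I := hι.1
    have : Module.Finite A Om := Module.Finite.of_surjective p.hom hp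
    obtain ⟨c₀, rfl⟩ := exists_cosyzygySeq k Om
    let c := c₀.cons ι p hι.2.1 hp hex inferInstance inferInstance (projective_of_injective k I)
      inferInstance
    have hMM : Orth (c.M 0) (c.M 0) := orth_iff_extZero.2 hso
    obtain ⟨t⟩ := nonempty_extensionTower k c
    obtain ⟨W', a, ha, hinj, hsurj⟩ := exists_sequential_union t.X t.f t.injective_f
    obtain ⟨h, hh⟩ := happrox.2 W' (t.memG_union hMM hns ha hinj hsurj) (t.e.hom ≫ a 0)
    obtain ⟨j, g, hg⟩ := exists_factor_of_isColimit hD (f ≫ e.inv)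
    have := (hF j).1
    obtain ⟨n, v, hv⟩ := exists_factor_of_union ha hinj hsurj (D.ι.app j ≫ e.hom ≫ h)
    refine t.projective_of_factor k hMM (memG_iff.1 (hF j).2).2 g v ?_
    have : Mono (a n) := (ModuleCat.mono_iff_injective _).2 (hinj n)
    have hgv : g ≫ v ≫ a n = f ≫ h := by
      rw [hv, reassoc_of% hg, e.inv_hom_id_assoc]
    exact (cancel_mono (a n)).1
      ((Category.assoc _ _ _).trans (hgv.trans (hh.symm.trans (t.base_comp ha n).symm)))
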